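/- arXiv:1306.3073 — 3 statements merged into one kernel-verified Lean document; each statement's English description precedes it below -/
import Mathlib

section
/- Let A ⊆ ℝ² be a locally connected continuum (a nonempty compact connected set that is locally connected as a subspace), and let S be a connected component of ℝ² \ A. Then the topological boundary ∂S of S in ℝ² is a locally connected continuum. -/
open Set Topology

lemma tz_exp_eq_one {z : ℂ} (h : Complex.exp z = 1) (hz : ‖z‖ < 1) : z = 0 := by
  obtain ⟨n, hn⟩ := Complex.exp_eq_one_iff.1 h
  rcases eq_or_ne n 0 with rfl | h0
  · simpa using hn
  · exfalso
    have h1 : (1 : ℝ) ≤ |(n : ℝ)| := by exact_mod_cast Int.one_le_abs h0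
    have : ‖z‖ = |(n : ℝ)| * (2 * Real.pi) := by
      rw [hn]; simp [abs_of_pos Real.pi_pos]
    nlinarith [Real.pi_gt_three]

lemma tz_const {X : Type*} [TopologicalSpace X] {s : Set X} (hs : IsPreconnected s)
    {h : X → ℂ} (hc : ContinuousOn h s) {c : ℂ} (he : ∀ x ∈ s, Complex.exp (h x) = c)
    {x y : X} (hx : x ∈ s) (hy : y ∈ s) : h x = h y := by
  refine hs.induction₂ (fun x y => h x = h y) ?_ (fun _ _ _ _ _ _ => Eq.trans)
    (fun _ _ _ _ => Eq.symm) hx hy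
  intro x hx
  have := (hc x hx) (Metric.ball_mem_nhds _ one_pos)
  filter_upwards [this, self_mem_nhdsWithin] with y hy hys
  have h1 : Complex.exp (h y - h x) = 1 := by
    rw [Complex.exp_sub, he y hys, he x hx, div_self]
    rw [← he x hx]; exact Complex.exp_ne_zero _
  have := tz_exp_eq_one h1 (by simpa [dist_eq_norm] using hy)
  exact (sub_eq_zero.1 this).symm

lemma tz_lift (f : ℝ × ℝ → ℂ) (hf : Continuous f) (h0 : ∀ x, f x ≠ 0) :
    ∃ g : ℝ × ℝ → ℂ, Continuous g ∧ ∀ x, Complex.exp (g x) = f x := by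
  obtain ⟨F, ⟨-, hF⟩, -⟩ := Complex.isCoveringMapOn_exp.existsUnique_continuousMap_lifts
    ⟨f, hf⟩ (a₀ := (0, 0)) (e₀ := Complex.log (f (0, 0))) (Complex.exp_log (h0 _)) (fun a => h0 a)
  exact ⟨F, F.continuous, fun x => congrFun hF x⟩

lemma tz_D (γ : ℝ → ℂ) (hγ : Continuous γ) (v : ℂ) (hv : ∀ t, γ t ≠ v) :
    ∃ k : ℤ, ∀ (L : ℝ → ℂ) (c : ℂ), Continuous L → c ≠ 0 → (∀ t, Complex.exp (L t) = c * (γ t - v)) →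
      L 1 - L 0 = Complex.log (γ 1 - v) - Complex.log (γ 0 - v) + k * (2 * Real.pi * Complex.I) := by
  obtain ⟨g, hg, hge⟩ := tz_lift (fun x => γ x.1 - v) (by fun_prop)
    (fun x => sub_ne_zero.2 (hv _))
  have h1 : Complex.exp ((g (1,0) - g (0,0)) - (Complex.log (γ 1 - v) - Complex.log (γ 0 - v))) = 1 := by
    rw [Complex.exp_sub, Complex.exp_sub, Complex.exp_sub, hge, hge,
      Complex.exp_log (sub_ne_zero.2 (hv _)), Complex.exp_log (sub_ne_zero.2 (hv _)), div_self]
    exact div_ne_zero (sub_ne_zero.2 (hv _)) (sub_ne_zero.2 (hv _))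
  obtain ⟨k, hk⟩ := Complex.exp_eq_one_iff.1 h1
  refine ⟨k, fun L c hL hc he => ?_⟩
  have := tz_const (s := (univ : Set ℝ)) isPreconnected_univ (h := fun t => L t - g (t, 0))
    (c := c) (by fun_prop) (fun t _ => by
      rw [Complex.exp_sub, he, hge]; exact mul_div_cancel_right₀ _ (sub_ne_zero.2 (hv _)))
    (mem_univ 1) (mem_univ 0)
  linear_combination this + hk

lemma tz_anti (v w : ℂ) (h : v ≠ w) : ∃ c : ℤ,
    Complex.log (w - v) - Complex.log (v - w) = (2 * c + 1) * (Real.pi * Complex.I) := by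
  have h1 : Complex.exp (Complex.log (w - v) - Complex.log (v - w) - Real.pi * Complex.I) = 1 := by
    rw [Complex.exp_sub, Complex.exp_sub, Complex.exp_log (sub_ne_zero.2 h.symm),
      Complex.exp_log (sub_ne_zero.2 h), Complex.exp_pi_mul_I]
    have := sub_ne_zero.2 h
    field_simp
    ring
  obtain ⟨k, hk⟩ := Complex.exp_eq_one_iff.1 h1
  exact ⟨k, by linear_combination hk⟩

lemma tz_k33 (a b : Fin 3 → ℂ) (γ : Fin 3 → Fin 3 → ℝ → ℂ) (hγ : ∀ i j, Continuous (γ i j))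
    (h0 : ∀ i j, γ i j 0 = a i) (h1 : ∀ i j, γ i j 1 = b j)
    (hd : ∀ i i' j j', i ≠ i' → j ≠ j' → ∀ s t, γ i j s ≠ γ i' j' t) : False := by
  have other : ∀ j : Fin 3, ∃ j', j' ≠ j := by decide
  have hA : ∀ i' i j, i' ≠ i → ∀ t, γ i j t ≠ a i' := by
    intro i' i j hi t
    obtain ⟨j', hj⟩ := other j
    rw [← h0 i' j']; exact hd _ _ _ _ hi.symm hj.symm _ _
  have hB : ∀ j' i j, j' ≠ j → ∀ t, γ i j t ≠ b j' := by
    intro j' i j hj t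
    obtain ⟨i', hi⟩ := other i
    rw [← h1 i' j']; exact hd _ _ _ _ hi.symm hj.symm _ _
  have hab : ∀ i j, a i ≠ b j := by
    intro i j
    obtain ⟨j', hj⟩ := other j
    rw [← h0 i j']; exact hB _ _ _ hj.symm _
  have haa : ∀ i i', i ≠ i' → a i ≠ a i' := by
    intro i i' hi
    rw [← h0 i 0]; exact hA _ _ _ hi.symm _
  have hbb : ∀ i i', i ≠ i' → b i ≠ b i' := by
    intro i i' hi
    rw [← h1 0 i]; exact hB _ _ _ hi.symm _
  have kA' : ∀ i' i j, ∃ k : ℤ, i' ≠ i → ∀ (L : ℝ → ℂ) (c : ℂ), Continuous L → c ≠ 0 →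
      (∀ t, Complex.exp (L t) = c * (γ i j t - a i')) →
      L 1 - L 0 = Complex.log (b j - a i') - Complex.log (a i - a i')
        + k * (2 * Real.pi * Complex.I) := by
    intro i' i j
    by_cases h : i' = i
    · exact ⟨0, fun h' => (h' h).elim⟩
    · obtain ⟨k, hk⟩ := tz_D (γ i j) (hγ i j) (a i') (hA _ _ _ h)
      rw [h0, h1] at hk
      exact ⟨k, fun _ => hk⟩
  have kB' : ∀ j' i j, ∃ k : ℤ, j' ≠ j → ∀ (L : ℝ → ℂ) (c : ℂ), Continuous L → c ≠ 0 →
      (∀ t, Complex.exp (L t) = c * (γ i j t - b j')) →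
      L 1 - L 0 = Complex.log (b j - b j') - Complex.log (a i - b j')
        + k * (2 * Real.pi * Complex.I) := by
    intro i' i j
    by_cases h : i' = j
    · exact ⟨0, fun h' => (h' h).elim⟩
    · obtain ⟨k, hk⟩ := tz_D (γ i j) (hγ i j) (b i') (hB _ _ _ h)
      rw [h0, h1] at hk
      exact ⟨k, fun _ => hk⟩
  choose kA hkA using kA'
  choose kB hkB using kB'
  have c' : ∀ i j, ∃ c : ℤ, Complex.log (b j - a i) - Complex.log (a i - b j)
      = (2 * c + 1) * (Real.pi * Complex.I) := fun i j => tz_anti _ _ (hab i j)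
  choose c hc using c'
  have p' : ∀ i i', ∃ c : ℤ, i ≠ i' → Complex.log (a i' - a i) - Complex.log (a i - a i')
      = (2 * c + 1) * (Real.pi * Complex.I) := by
    intro i j
    by_cases h : i = j
    · exact ⟨0, fun h' => (h' h).elim⟩
    · obtain ⟨k, hk⟩ := tz_anti _ _ (haa i j h)
      exact ⟨k, fun _ => hk⟩
  choose p hp using p'
  have q' : ∀ i i', ∃ c : ℤ, i ≠ i' → Complex.log (b i' - b i) - Complex.log (b i - b i')
      = (2 * c + 1) * (Real.pi * Complex.I) := by
    intro i j
    by_cases h : i = j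
    · exact ⟨0, fun h' => (h' h).elim⟩
    · obtain ⟨k, hk⟩ := tz_anti _ _ (hbb i j h)
      exact ⟨k, fun _ => hk⟩
  choose q hq using q'
  have hpi : (Real.pi * Complex.I : ℂ) ≠ 0 :=
    mul_ne_zero (by exact_mod_cast Real.pi_ne_zero) Complex.I_ne_zero
  have hqs : ∀ j j', j ≠ j' → q j' j = - q j j' - 1 := by
    intro j j' h
    have e1 := hq j j' h
    have e2 := hq j' j h.symm
    have : (((2 * (q j j' + q j' j + 1) : ℤ) : ℂ)) * (Real.pi * Complex.I) = 0 := by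
      push_cast; linear_combination - e1 - e2
    have := (mul_eq_zero.1 this).resolve_right hpi
    have : 2 * (q j j' + q j' j + 1) = 0 := by exact_mod_cast this
    omega
  have key : ∀ i i' j j', i ≠ i' → j ≠ j' →
      c i' j - c i j' + p i i' + q j j' + 1 + kA i' i j + kB j i' j' - kB j' i j - kA i i' j' = 0 := by
    intro i i' j j' hi hj
    obtain ⟨G, hG, hGe⟩ := tz_lift (fun x => γ i j x.1 - γ i' j' x.2)
      (by have := hγ i j; have := hγ i' j'; fun_prop)
      (fun x => sub_ne_zero.2 (hd _ _ _ _ hi hj _ _))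
    have e1 := hkA i' i j hi.symm (fun t => G (t, 0)) 1 (by fun_prop) one_ne_zero
      (fun t => by rw [hGe]; simp [h0])
    have e2 := hkB j' i j hj.symm (fun t => G (t, 1)) 1 (by fun_prop) one_ne_zero
      (fun t => by rw [hGe]; simp [h1])
    have e3 := hkB j i' j' hj (fun t => G (1, t)) (-1) (by fun_prop) (by norm_num)
      (fun t => by rw [hGe]; simp [h1])
    have e4 := hkA i i' j' hi (fun t => G (0, t)) (-1) (by fun_prop) (by norm_num)
      (fun t => by rw [hGe]; simp [h0])
    have f1 := hc i' j
    have f2 := hc i j'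
    have f3 := hp i i' hi
    have f4 := hq j j' hj
    have : (((2 * (c i' j - c i j' + p i i' + q j j' + 1 + kA i' i j + kB j i' j' - kB j' i j - kA i i' j') : ℤ) : ℂ)) * (Real.pi * Complex.I) = 0 := by
      push_cast
      linear_combination e2 + e4 - e1 - e3 - f1 + f2 - f3 - f4
    have := (mul_eq_zero.1 this).resolve_right hpi
    have : 2 * (c i' j - c i j' + p i i' + q j j' + 1 + kA i' i j + kB j i' j' - kB j' i j - kA i i' j') = 0 := by exact_mod_cast this
    omega
  have s1 : ∀ i i' : Fin 3, i ≠ i' → ∀ j j' : Fin 3, j ≠ j' → _ := fun i i' hi j j' hj => key i i' j j' hi hj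
  have r1 := hqs 0 1 (by decide)
  have r2 := hqs 0 2 (by decide)
  have r3 := hqs 1 2 (by decide)
  have t (i i' : Fin 3) (h : i ≠ i') := And.intro (key i i' 0 1 h (by decide))
    (And.intro (key i i' 1 0 h (by decide)) (And.intro (key i i' 0 2 h (by decide))
    (And.intro (key i i' 2 0 h (by decide)) (And.intro (key i i' 1 2 h (by decide))
      (key i i' 2 1 h (by decide))))))
  have t1 := t 0 1 (by decide)
  have t2 := t 0 2 (by decide)
  have t3 := t 1 2 (by decide)
  clear t key s1 hqs
  omega

lemma tz_k33_sets (a b : Fin 3 → ℝ × ℝ) (E : Fin 3 → Fin 3 → Set (ℝ × ℝ))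
    (hE : ∀ i j, IsCompact (E i j)) (hE' : ∀ i j, IsPreconnected (E i j))
    (ha : ∀ i j, a i ∈ E i j) (hb : ∀ i j, b j ∈ E i j)
    (hd : ∀ i i' j j', i ≠ i' → j ≠ j' → Disjoint (E i j) (E i' j')) : False := by
  have h1 : ∀ᶠ δ in 𝓝[>] (0 : ℝ), ∀ i i' j j', i ≠ i' → j ≠ j' →
      Disjoint (Metric.thickening δ (E i j)) (Metric.thickening δ (E i' j')) := by
    simp only [Filter.eventually_all]
    intro i i' j j' hi hj
    obtain ⟨δ, hδ, h⟩ := (hd i i' j j' hi hj).exists_thickenings (hE i j) (hE i' j').isClosed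
    filter_upwards [Ioo_mem_nhdsGT hδ] with ε hε
    exact h.mono (Metric.thickening_mono hε.2.le _) (Metric.thickening_mono hε.2.le _)
  obtain ⟨δ, hδ, hpos⟩ := (h1.and self_mem_nhdsWithin).exists
  have hpos : 0 < δ := hpos
  have hJ : ∀ i j, JoinedIn (Metric.thickening δ (E i j)) (a i) (b j) := by
    intro i j
    have hsub := Metric.self_subset_thickening hpos (E i j)
    have ho : IsOpen (connectedComponentIn (Metric.thickening δ (E i j)) (a i)) :=
      Metric.isOpen_thickening.connectedComponentIn
    have hc : IsConnected (connectedComponentIn (Metric.thickening δ (E i j)) (a i)) :=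
      isConnected_connectedComponentIn_iff.2 (hsub (ha i j))
    have hp := (ho.isConnected_iff_isPathConnected).1 hc
    have := (hE' i j).subset_connectedComponentIn (ha i j) hsub
    exact (hp.joinedIn _ (this (ha i j)) _ (this (hb i j))).mono (connectedComponentIn_subset _ _)
  let e := Complex.equivRealProdCLM.symm
  refine tz_k33 (fun i => e (a i)) (fun j => e (b j))
    (fun i j t => e ((hJ i j).somePath.extend t)) ?_ ?_ ?_ ?_
  · intro i j
    exact e.continuous.comp (hJ i j).somePath.continuous_extend
  · intro i j; simp
  · intro i j; simp
  · intro i i' j j' hi hj s t h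
    have h := e.injective h
    have m1 : (hJ i j).somePath.extend s ∈ Metric.thickening δ (E i j) := by
      obtain ⟨u, hu⟩ : (hJ i j).somePath.extend s ∈ range (hJ i j).somePath := by
        rw [← Path.extend_range]; exact mem_range_self _
      rw [← hu]; exact (hJ i j).somePath_mem u
    have m2 : (hJ i' j').somePath.extend t ∈ Metric.thickening δ (E i' j') := by
      obtain ⟨u, hu⟩ : (hJ i' j').somePath.extend t ∈ range (hJ i' j').somePath := by
        rw [← Path.extend_range]; exact mem_range_self _
      rw [← hu]; exact (hJ i' j').somePath_mem u
    rw [← h] at m2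
    exact disjoint_left.1 (hδ i i' j j' hi hj) m1 m2

lemma tz_unicoherent (F G : Set (ℝ × ℝ)) (hF : IsClosed F) (hG : IsClosed G)
    (hF' : IsPreconnected F) (hG' : IsPreconnected G) (hU : F ∪ G = univ) :
    IsPreconnected (F ∩ G) := by
  rw [isPreconnected_closed_iff]
  intro t t' ht ht' hsub hne hne'
  by_contra hcon
  have hdisj : Disjoint (F ∩ G ∩ t) (F ∩ G ∩ t') := by
    rw [disjoint_left]
    intro x hx hx'
    exact hcon ⟨x, hx.1, hx.2, hx'.2⟩
  obtain ⟨u, hu0, hu1, -⟩ := exists_continuous_zero_one_of_isClosed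
    ((hF.inter hG).inter ht) ((hF.inter hG).inter ht') hdisj
  classical
  let f : ℝ × ℝ → ℂ := fun x => if x ∈ F then Complex.exp (u x * (Real.pi * Complex.I)) else
    Complex.exp (-(u x * (Real.pi * Complex.I)))
  have hfF : ∀ x ∈ F, f x = Complex.exp (u x * (Real.pi * Complex.I)) := fun x hx => if_pos hx
  have hfG : ∀ x ∈ G, f x = Complex.exp (-(u x * (Real.pi * Complex.I))) := by
    intro x hx
    by_cases hxF : x ∈ F
    · rw [hfF x hxF]
      rcases hsub ⟨hxF, hx⟩ with h | h
      · have := hu0 ⟨⟨hxF, hx⟩, h⟩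
        simp [this]
      · have := hu1 ⟨⟨hxF, hx⟩, h⟩
        simp [this, Complex.exp_neg]
    · exact if_neg hxF
  have hfc : Continuous f := by
    rw [← continuousOn_univ, ← hU]
    refine ContinuousOn.union_of_isClosed ?_ ?_ hF hG
    · exact ContinuousOn.congr (by fun_prop) hfF
    · exact ContinuousOn.congr (by fun_prop) hfG
  obtain ⟨g, hg, hge⟩ := tz_lift f hfc (fun x => by
    simp only [f]; split_ifs <;> exact Complex.exp_ne_zero _)
  obtain ⟨x, ⟨hxF, hxG⟩, hxt⟩ := hne
  obtain ⟨y, ⟨hyF, hyG⟩, hyt⟩ := hne'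
  have hx0 : u x = 0 := hu0 ⟨⟨hxF, hxG⟩, hxt⟩
  have hy1 : u y = 1 := hu1 ⟨⟨hyF, hyG⟩, hyt⟩
  have e1 := tz_const hF' (h := fun x => g x - (u x * (Real.pi * Complex.I))) (c := 1)
    (by fun_prop) (fun z hz => by
      rw [Complex.exp_sub, hge, hfF z hz, div_self (Complex.exp_ne_zero _)]) hxF hyF
  have e2 := tz_const hG' (h := fun x => g x + (u x * (Real.pi * Complex.I))) (c := 1)
    (by fun_prop) (fun z hz => by
      rw [Complex.exp_add, hge, hfG z hz, ← Complex.exp_add]; simp) hxG hyG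
  simp only [hx0, hy1] at e1 e2
  have : (Real.pi * Complex.I : ℂ) = 0 := by
    push_cast at e1 e2
    linear_combination (e1 - e2) / 2
  exact mul_ne_zero (by exact_mod_cast Real.pi_ne_zero) Complex.I_ne_zero this

lemma tz_frontier_sub (A : Set (ℝ × ℝ)) (hA : IsClosed A) (x : ℝ × ℝ) :
    frontier (connectedComponentIn Aᶜ x) ⊆ A := by
  intro y hy
  by_contra hyA
  have ho : IsOpen (connectedComponentIn Aᶜ y) := hA.isOpen_compl.connectedComponentIn
  have hoS : IsOpen (connectedComponentIn Aᶜ x) := hA.isOpen_compl.connectedComponentIn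
  have hm := mem_connectedComponentIn (F := Aᶜ) hyA
  obtain ⟨z, hz, hzS⟩ := mem_closure_iff.1 hy.1 _ ho hm
  have := connectedComponentIn_eq hz
  rw [connectedComponentIn_eq hzS, ← this] at hy
  rw [ho.frontier_eq] at hy
  exact hy.2 hm

lemma tz_frontier_nonempty (A : Set (ℝ × ℝ)) (hA : A.Nonempty) (x : ℝ × ℝ) (hx : x ∈ Aᶜ) :
    (frontier (connectedComponentIn Aᶜ x)).Nonempty := by
  rw [nonempty_frontier_iff]
  refine ⟨⟨x, mem_connectedComponentIn hx⟩, fun h => ?_⟩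
  obtain ⟨a, ha⟩ := hA
  exact connectedComponentIn_subset Aᶜ x (h ▸ mem_univ a) ha

lemma tz_frontier_conn (A : Set (ℝ × ℝ)) (hA : IsClosed A) (hAc : IsConnected A)
    (x : ℝ × ℝ) : IsPreconnected (frontier (connectedComponentIn Aᶜ x)) := by
  have hoS : IsOpen (connectedComponentIn Aᶜ x) := hA.isOpen_compl.connectedComponentIn
  have hsub := connectedComponentIn_subset Aᶜ x
  rw [hoS.frontier_eq, sdiff_eq]
  refine tz_unicoherent _ _ isClosed_closure hoS.isClosed_compl
    isPreconnected_connectedComponentIn.closure ?_ ?_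
  · obtain ⟨a, ha⟩ := hAc.nonempty
    have hAS : A ⊆ (connectedComponentIn Aᶜ x)ᶜ := fun z hz hzS => hsub hzS hz
    refine isPreconnected_of_forall a fun y hy => ?_
    by_cases hyA : y ∈ A
    · exact ⟨A, hAS, ha, hyA, hAc.isPreconnected⟩
    · obtain ⟨z, hz⟩ := tz_frontier_nonempty A hAc.nonempty y hyA
      refine ⟨A ∪ closure (connectedComponentIn Aᶜ y), union_subset hAS ?_, Or.inl ha,
        Or.inr (subset_closure (mem_connectedComponentIn hyA)),
        IsPreconnected.union z (tz_frontier_sub A hA y hz) hz.1 hAc.isPreconnected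
          isPreconnected_connectedComponentIn.closure⟩
      have hd : Disjoint (connectedComponentIn Aᶜ y) (connectedComponentIn Aᶜ x) := by
        rw [disjoint_left]
        intro w hw hw'
        apply hy
        rw [connectedComponentIn_eq hw', ← connectedComponentIn_eq hw]
        exact mem_connectedComponentIn hyA
      exact fun w hw hw' => disjoint_left.1 (hd.closure_left hoS) hw hw'
  · refine eq_univ_of_forall fun y => ?_
    by_cases h : y ∈ connectedComponentIn Aᶜ x
    · exact Or.inl (subset_closure h)
    · exact Or.inr h

def tzJ (A U : Set (ℝ × ℝ)) (x y : ℝ × ℝ) : Prop :=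
  ∃ E, IsCompact E ∧ IsPreconnected E ∧ E ⊆ A ∩ U ∧ x ∈ E ∧ y ∈ E

lemma tzJ.symm {A U : Set (ℝ × ℝ)} {x y : ℝ × ℝ} (h : tzJ A U x y) : tzJ A U y x := by
  obtain ⟨E, h1, h2, h3, h4, h5⟩ := h
  exact ⟨E, h1, h2, h3, h5, h4⟩

lemma tzJ.trans {A U : Set (ℝ × ℝ)} {x y z : ℝ × ℝ} (h : tzJ A U x y) (h' : tzJ A U y z) :
    tzJ A U x z := by
  obtain ⟨E, h1, h2, h3, h4, h5⟩ := h
  obtain ⟨E', h1', h2', h3', h4', h5'⟩ := h'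
  exact ⟨E ∪ E', h1.union h1', h2.union y h5 h4' h2', union_subset h3 h3', Or.inl h4, Or.inr h5'⟩

lemma tzJ.mono {A U V : Set (ℝ × ℝ)} {x y : ℝ × ℝ} (h : tzJ A U x y) (hUV : U ⊆ V) :
    tzJ A V x y := by
  obtain ⟨E, h1, h2, h3, h4, h5⟩ := h
  exact ⟨E, h1, h2, h3.trans (inter_subset_inter_right _ hUV), h4, h5⟩

lemma tzJ.refl {A U : Set (ℝ × ℝ)} {x : ℝ × ℝ} (h : x ∈ A) (h' : x ∈ U) : tzJ A U x x :=
  ⟨{x}, isCompact_singleton, isPreconnected_singleton, by simp [h, h'], rfl, rfl⟩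

lemma tzJ.left {A U : Set (ℝ × ℝ)} {x y : ℝ × ℝ} (h : tzJ A U x y) : x ∈ A ∩ U := by
  obtain ⟨E, h1, h2, h3, h4, h5⟩ := h
  exact h3 h4

lemma tzJ_local {A U : Set (ℝ × ℝ)} (hA : IsClosed A) (hl : LocallyConnectedSpace A)
    (hU : IsOpen U) {x : ℝ × ℝ} (hx : x ∈ A) (hxU : x ∈ U) :
    ∀ᶠ y in 𝓝[A] x, tzJ A U x y := by
  obtain ⟨ε, hε, hb⟩ := Metric.nhds_basis_closedBall.mem_iff.1 (hU.mem_nhds hxU)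
  obtain ⟨V, hV, hVc, hVs⟩ := locallyConnectedSpace_iff_connected_subsets.1 hl ⟨x, hx⟩
    (Subtype.val ⁻¹' Metric.closedBall x ε)
    (continuous_subtype_val.continuousAt.preimage_mem_nhds (Metric.closedBall_mem_nhds x hε))
  have hxV := mem_of_mem_nhds hV
  have hsubB : closure (Subtype.val '' V) ⊆ Metric.closedBall x ε :=
    closure_minimal (image_subset_iff.2 hVs) Metric.isClosed_closedBall
  have hsubA : closure (Subtype.val '' V) ⊆ A := by
    refine closure_minimal ?_ hA
    rintro _ ⟨z, -, rfl⟩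
    exact z.2
  rw [nhdsWithin_eq_map_subtype_coe hx, Filter.eventually_map]
  filter_upwards [hV] with y hy
  exact ⟨closure (Subtype.val '' V), (isCompact_closedBall x ε).of_isClosed_subset isClosed_closure
    hsubB, (hVc.image _ continuous_subtype_val.continuousOn).closure,
    subset_inter hsubA (hsubB.trans hb), subset_closure ⟨_, hxV, rfl⟩, subset_closure ⟨_, hy, rfl⟩⟩

lemma tz_leg {A C U K M : Set (ℝ × ℝ)} (hA : IsClosed A) (hl : LocallyConnectedSpace A)
    (hC : IsPreconnected C) (hCA : C ⊆ A) (hU : IsOpen U) (hCU : C ⊆ U)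
    (hK : IsClosed K) (hM : IsClosed M) (hKM : Disjoint K M)
    (hCK : (C ∩ K).Nonempty) (hCM : (C ∩ M).Nonempty) :
    ∃ x ∈ C, (∃ k ∈ K, tzJ A (U \ M) x k) ∧ (∃ m ∈ M, tzJ A (U \ K) x m) := by
  obtain ⟨k0, hk0C, hk0⟩ := hCK
  obtain ⟨m0, hm0C, hm0⟩ := hCM
  have loc : ∀ {V : Set (ℝ × ℝ)} {x : ℝ × ℝ}, IsOpen V → x ∈ C → x ∈ V →
      ∀ᶠ y in 𝓝[C] x, tzJ A V x y := fun hV hx hxV =>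
    nhdsWithin_mono _ hCA (tzJ_local hA hl hV (hCA hx) hxV)
  have hUM : IsOpen (U \ M) := hU.sdiff hM
  have hUK : IsOpen (U \ K) := hU.sdiff hK
  have cover : ∀ x ∈ C, (∃ k ∈ K, tzJ A (U \ M) x k) ∨ (∃ m ∈ M, tzJ A (U \ K) x m) := by
    intro x hx
    by_contra! hcon
    obtain ⟨h1, h2⟩ := hcon
    have hxK : x ∉ K := fun h => h1 x h (tzJ.refl (hCA hx) ⟨hCU hx, disjoint_left.1 hKM h⟩)
    have hxM : x ∉ M := fun h => h2 x h (tzJ.refl (hCA hx) ⟨hCU hx, disjoint_right.1 hKM h⟩)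
    have hUKM : IsOpen (U \ (K ∪ M)) := hU.sdiff (hK.union hM)
    have key := hC.induction₂
      (fun y z => (tzJ A (U \ (K ∪ M)) x y ↔ tzJ A (U \ (K ∪ M)) x z)) ?_
      (fun _ _ _ _ _ _ => Iff.trans) (fun _ _ _ _ => Iff.symm) hx hk0C
    · have := (key.1 (tzJ.refl (hCA hx) ⟨hCU hx, by simp [hxK, hxM]⟩)).symm.left.2.2
      exact this (Or.inl hk0)
    · intro y hy
      by_cases hyK : y ∈ K
      · have hyM := disjoint_left.1 hKM hyK
        filter_upwards [loc hUM hy ⟨hCU hy, hyM⟩] with z hz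
        refine iff_of_false (fun h => h.symm.left.2.2 (Or.inl hyK)) (fun h => ?_)
        exact h1 y hyK ((h.mono (sdiff_subset_sdiff_right subset_union_right)).trans hz.symm)
      · by_cases hyM : y ∈ M
        · filter_upwards [loc hUK hy ⟨hCU hy, hyK⟩] with z hz
          refine iff_of_false (fun h => h.symm.left.2.2 (Or.inr hyM)) (fun h => ?_)
          exact h2 y hyM ((h.mono (sdiff_subset_sdiff_right subset_union_left)).trans hz.symm)
        · filter_upwards [loc hUKM hy ⟨hCU hy, by simp [hyK, hyM]⟩] with z hz
          exact ⟨fun h => h.trans hz, fun h => h.trans hz.symm⟩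
  by_contra! hcon
  have key := hC.induction₂
      (fun y z => ((∃ k ∈ K, tzJ A (U \ M) y k) ↔ (∃ k ∈ K, tzJ A (U \ M) z k))) ?_
      (fun _ _ _ _ _ _ => Iff.trans) (fun _ _ _ _ => Iff.symm) hk0C hm0C
  · obtain hh := key.1 ⟨k0, hk0, tzJ.refl (hCA hk0C) ⟨hCU hk0C, disjoint_left.1 hKM hk0⟩⟩
    exact hcon m0 hm0C hh m0 hm0 (tzJ.refl (hCA hm0C) ⟨hCU hm0C, disjoint_right.1 hKM hm0⟩)
  · intro y hy
    rcases cover y hy with ⟨k, hk, h⟩ | ⟨m, hm, h⟩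
    · filter_upwards [loc hUM hy h.left.2] with z hz
      exact iff_of_true ⟨k, hk, h⟩ ⟨k, hk, hz.symm.trans h⟩
    · filter_upwards [loc hUK hy h.left.2, self_mem_nhdsWithin] with z hz hzC
      exact iff_of_false (fun h' => hcon y hy h' m hm h)
        (fun h' => hcon z hzC h' m hm (hz.symm.trans h))

lemma tz_bump {B : Set (ℝ × ℝ)} (hB : IsCompact B) (hBc : IsPreconnected B) {p q : ℝ × ℝ}
    (hp : p ∈ B) (hq : q ∈ B) {ε : ℝ} (hqε : dist q p < ε)
    (hpC : p ∉ connectedComponentIn (B ∩ Metric.closedBall p ε) q) :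
    ∃ r ∈ connectedComponentIn (B ∩ Metric.closedBall p ε) q, dist r p = ε := by
  by_contra! hcon
  have hε : 0 < ε := dist_nonneg.trans_lt hqε
  set X := B ∩ Metric.closedBall p ε with hX
  have hXc : IsCompact X := hB.inter_right Metric.isClosed_closedBall
  have : CompactSpace X := isCompact_iff_compactSpace.1 hXc
  have hqX : q ∈ X := ⟨hq, hqε.le⟩
  rw [connectedComponentIn_eq_image hqX] at hpC hcon
  let T : Set X := {z | dist z.1 p = ε} ∪ {z | z.1 = p}
  have hT : IsClosed T := (isClosed_eq (by fun_prop) continuous_const).union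
    (isClosed_eq (by fun_prop) continuous_const)
  have hTe : T ∩ ⋂ s : { s : Set X // IsClopen s ∧ (⟨q, hqX⟩ : X) ∈ s }, s.1 = ∅ := by
    rw [← connectedComponent_eq_iInter_isClopen]
    ext z
    simp only [mem_inter_iff, mem_empty_iff_false, iff_false, not_and]
    rintro (h | h) hz
    · exact hcon _ ⟨z, hz, rfl⟩ h
    · exact hpC ⟨z, hz, h⟩
  obtain ⟨u, hu⟩ := hT.isCompact.elim_finite_subfamily_closed _ (fun s => s.2.1.1) hTe
  let W : Set X := ⋂ i ∈ u, i.1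
  have hW : IsClopen W := isClopen_biInter_finset fun i _ => i.2.1
  have hqW : (⟨q, hqX⟩ : X) ∈ W := mem_iInter₂.2 fun i _ => i.2.2
  obtain ⟨O, hO, hOW⟩ := isOpen_induced_iff.1 hW.2
  have hW' : IsClosed (Subtype.val '' W) :=
    (hW.1.isCompact.image continuous_subtype_val).isClosed
  have hpW : p ∉ Subtype.val '' W := by
    rintro ⟨z, hz, hzp⟩
    have : z ∈ T ∩ W := ⟨Or.inr hzp, hz⟩
    rw [hu] at this; exact this
  have := hBc (Metric.ball p ε ∩ O) (Subtype.val '' W)ᶜ (Metric.isOpen_ball.inter hO)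
    hW'.isOpen_compl ?_ ⟨q, hq, hqε, by
      have : (⟨q, hqX⟩ : X) ∈ Subtype.val ⁻¹' O := hOW ▸ hqW
      exact this⟩ ⟨p, hp, hpW⟩
  · obtain ⟨z, hzB, ⟨hz1, hz2⟩, hz3⟩ := this
    apply hz3
    refine ⟨⟨z, hzB, Metric.ball_subset_closedBall hz1⟩, ?_, rfl⟩
    rw [← hOW]; exact hz2
  · intro z hz
    by_cases hzW : z ∈ Subtype.val '' W
    · left
      obtain ⟨w, hw, rfl⟩ := hzW
      refine ⟨?_, ?_⟩
      · refine Metric.mem_ball.2 (lt_of_le_of_ne (Metric.mem_closedBall.1 w.2.2) fun h => ?_)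
        have : w ∈ T ∩ W := ⟨Or.inl h, hw⟩
        rw [hu] at this; exact this
      · have : w ∈ Subtype.val ⁻¹' O := hOW ▸ hw
        exact this
    · exact Or.inr hzW

lemma tz_three {A S : Set (ℝ × ℝ)} (hA : IsClosed A) (hl : LocallyConnectedSpace A)
    (hS : IsOpen S) (hSc : IsConnected S) (hSA : Disjoint S A) (hfA : frontier S ⊆ A)
    (C : Fin 3 → Set (ℝ × ℝ)) (hC : ∀ i, IsCompact (C i)) (hC' : ∀ i, IsPreconnected (C i))
    (hCf : ∀ i, C i ⊆ frontier S) (hCd : ∀ i j, i ≠ j → Disjoint (C i) (C j))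
    (p r : ℝ × ℝ) (V W : Set (ℝ × ℝ)) (hVW : Disjoint V W)
    (hK : ∀ i, ∃ k ∈ C i, tzJ A V p k) (hM : ∀ i, ∃ m ∈ C i, tzJ A W r m) : False := by
  choose k0 hk0C K hKc hKp hKA hpK hk0K using hK
  choose m0 hm0C M hMc hMp hMA hrM hm0M using hM
  have hKc' : IsCompact (⋃ i, K i) := isCompact_iUnion hKc
  have hMc' : IsCompact (⋃ i, M i) := isCompact_iUnion hMc
  have hKp' : IsPreconnected (⋃ i, K i) :=
    isPreconnected_iUnion ⟨p, mem_iInter.2 hpK⟩ hKp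
  have hMp' : IsPreconnected (⋃ i, M i) :=
    isPreconnected_iUnion ⟨r, mem_iInter.2 hrM⟩ hMp
  have hKA' : (⋃ i, K i) ⊆ A ∩ V := iUnion_subset hKA
  have hMA' : (⋃ i, M i) ⊆ A ∩ W := iUnion_subset hMA
  have hpK' : p ∈ ⋃ i, K i := mem_iUnion.2 ⟨0, hpK 0⟩
  have hrM' : r ∈ ⋃ i, M i := mem_iUnion.2 ⟨0, hrM 0⟩
  have hCK : ∀ i, (C i ∩ ⋃ i, K i).Nonempty := fun i => ⟨k0 i, hk0C i, mem_iUnion.2 ⟨i, hk0K i⟩⟩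
  have hCM : ∀ i, (C i ∩ ⋃ i, M i).Nonempty := fun i => ⟨m0 i, hm0C i, mem_iUnion.2 ⟨i, hm0M i⟩⟩
  generalize (⋃ i, K i) = KK at *
  generalize (⋃ i, M i) = MM at *
  clear hk0K hm0M hKc hKp hKA hpK hMc hMp hMA hrM hk0C hm0C
  have hKM : Disjoint KK MM :=
    hVW.mono (hKA'.trans inter_subset_right) (hMA'.trans inter_subset_right)
  have h1 : ∀ᶠ δ in 𝓝[>] (0 : ℝ), ∀ i i', i ≠ i' →
      Disjoint (Metric.thickening δ (C i)) (Metric.thickening δ (C i')) := by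
    simp only [Filter.eventually_all]
    intro i i' hi
    obtain ⟨δ, hδ, h⟩ := (hCd i i' hi).exists_thickenings (hC i) (hC i').isClosed
    filter_upwards [Ioo_mem_nhdsGT hδ] with ε hε
    exact h.mono (Metric.thickening_mono hε.2.le _) (Metric.thickening_mono hε.2.le _)
  obtain ⟨δ, hδ, hpos⟩ := (h1.and self_mem_nhdsWithin).exists
  have hpos : 0 < δ := hpos
  have hleg := fun i => tz_leg hA hl (hC' i) ((hCf i).trans hfA)
    (Metric.isOpen_thickening (δ := δ)) (Metric.self_subset_thickening hpos (C i))
    hKc'.isClosed hMc'.isClosed hKM (hCK i) (hCM i)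
  choose x hxC hleg using hleg
  choose hF hG using hleg
  choose k hk F hFc hFp hFA hxF hkF using hF
  choose m hm G hGc hGp hGA hxG hmG using hG
  have hFU : ∀ i, F i ⊆ Metric.thickening δ (C i) := fun i => (hFA i).trans fun z hz => hz.2.1
  have hGU : ∀ i, G i ⊆ Metric.thickening δ (C i) := fun i => (hGA i).trans fun z hz => hz.2.1
  have hFM : ∀ i, Disjoint (F i) MM := fun i => disjoint_left.2 fun z hz => (hFA i hz).2.2
  have hGK : ∀ i, Disjoint (G i) KK := fun i => disjoint_left.2 fun z hz => (hGA i hz).2.2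
  obtain ⟨s0, hs0⟩ := hSc.nonempty
  have hZ : ∀ i, ∃ Z, IsCompact Z ∧ IsPreconnected Z ∧ x i ∈ Z ∧ s0 ∈ Z ∧
      ∀ j, i ≠ j → Disjoint Z (KK ∪ F j) ∧ Disjoint Z (MM ∪ G j) := by
    intro i
    have ev : ∀ᶠ y in 𝓝 (x i), ∀ j, i ≠ j → y ∉ (KK ∪ F j) ∪ (MM ∪ G j) := by
      simp only [Filter.eventually_all]
      intro j hij
      refine IsOpen.mem_nhds (((hKc'.union (hFc j)).union
        (hMc'.union (hGc j))).isClosed.isOpen_compl) ?_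
      rintro ((h | h) | (h | h))
      · exact disjoint_left.1 (hGK i) (hxG i) h
      · exact disjoint_left.1 (hδ i j hij) (hFU i (hxF i)) (hFU j h)
      · exact disjoint_left.1 (hFM i) (hxF i) h
      · exact disjoint_left.1 (hδ i j hij) (hFU i (hxF i)) (hGU j h)
    obtain ⟨ρ, hρ, hball⟩ := Metric.eventually_nhds_iff_ball.1 ev
    obtain ⟨s, hsb, hsS⟩ := mem_closure_iff.1 (hCf i (hxC i)).1 _ Metric.isOpen_ball
      (Metric.mem_ball_self hρ)
    have hj := ((hS.isConnected_iff_isPathConnected).1 hSc).joinedIn _ hsS _ hs0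
    have hseg : segment ℝ (x i) s ⊆ Metric.ball (x i) ρ :=
      (convex_ball (x i) ρ).segment_subset (Metric.mem_ball_self hρ) hsb
    have hdis : ∀ j, i ≠ j → Disjoint (segment ℝ (x i) s ∪ range hj.somePath)
        ((KK ∪ F j) ∪ (MM ∪ G j)) := by
      intro j hij
      rw [disjoint_left]
      rintro z (hz | ⟨t, rfl⟩) hz'
      · exact hball z (hseg hz) j hij hz'
      · refine disjoint_left.1 hSA (hj.somePath_mem t) ?_
        rcases hz' with ((h | h) | (h | h))
        · exact (hKA' h).1
        · exact (hFA j h).1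
        · exact (hMA' h).1
        · exact (hGA j h).1
    refine ⟨segment ℝ (x i) s ∪ range hj.somePath, ?_, ?_, Or.inl (left_mem_segment ℝ _ _),
      Or.inr ⟨1, by simp⟩, fun j hij => ⟨(hdis j hij).mono_right subset_union_left,
        (hdis j hij).mono_right subset_union_right⟩⟩
    · refine IsCompact.union ?_ (isCompact_range hj.somePath.continuous)
      rw [segment_eq_image_lineMap]
      exact isCompact_Icc.image (by fun_prop)
    · exact IsPreconnected.union s (right_mem_segment ℝ _ _) ⟨0, by simp⟩
        (convex_segment _ _).isPreconnected (isPreconnected_range hj.somePath.continuous)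
  choose Z hZc hZp hxZ hsZ hZd using hZ
  have hKMd : ∀ i j, i ≠ j → Disjoint (KK ∪ F i) (MM ∪ G j) := by
    intro i j hij
    rw [disjoint_union_left, disjoint_union_right, disjoint_union_right]
    exact ⟨⟨hKM, (hGK j).symm⟩, hFM i, (hδ i j hij).mono (hFU i) (hGU j)⟩
  refine tz_k33_sets x ![p, r, s0] (fun i => ![KK ∪ F i, MM ∪ G i, Z i]) ?_ ?_ ?_ ?_ ?_
  · intro i j
    fin_cases j
    · exact hKc'.union (hFc i)
    · exact hMc'.union (hGc i)
    · exact hZc i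
  · intro i j
    fin_cases j
    · exact hKp'.union (k i) (hk i) (hkF i) (hFp i)
    · exact hMp'.union (m i) (hm i) (hmG i) (hGp i)
    · exact hZp i
  · intro i j
    fin_cases j
    · exact Or.inr (hxF i)
    · exact Or.inr (hxG i)
    · exact hxZ i
  · intro i j
    fin_cases j
    · exact Or.inl hpK'
    · exact Or.inl hrM'
    · exact hsZ i
  · intro i i' j j' hi hj
    fin_cases j <;> fin_cases j'
    · exact absurd rfl hj
    · exact hKMd i i' hi
    · exact (hZd i' i hi.symm).1.symm
    · exact (hKMd i' i hi.symm).symm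
    · exact absurd rfl hj
    · exact (hZd i' i hi.symm).2.symm
    · exact (hZd i i' hi).1
    · exact (hZd i i' hi).2
    · exact absurd rfl hj

lemma tz_cik {A S : Set (ℝ × ℝ)} (hA : IsClosed A) (hl : LocallyConnectedSpace A)
    (hS : IsOpen S) (hSc : IsConnected S) (hSA : Disjoint S A) (hfA : frontier S ⊆ A)
    (hfc : IsCompact (frontier S)) (hfp : IsPreconnected (frontier S))
    {p : ℝ × ℝ} (hp : p ∈ frontier S) {ε : ℝ} (hε : 0 < ε) :
    ∃ δ > 0, ∀ q ∈ frontier S, dist q p < δ →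
      p ∈ connectedComponentIn (frontier S ∩ Metric.closedBall p ε) q := by
  by_contra! hcon
  have hseq : ∀ n : ℕ, ∃ q ∈ frontier S, dist q p < min (1 / ((n : ℝ) + 1)) ε ∧
      p ∉ connectedComponentIn (frontier S ∩ Metric.closedBall p ε) q := fun n =>
    hcon _ (lt_min (by positivity) hε)
  choose q hqf hqd hpq using hseq
  set C : ℕ → Set (ℝ × ℝ) :=
    fun n => connectedComponentIn (frontier S ∩ Metric.closedBall p ε) (q n) with hCdef
  have hqX : ∀ n, q n ∈ frontier S ∩ Metric.closedBall p ε := fun n =>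
    ⟨hqf n, ((hqd n).trans_le (min_le_right _ _)).le⟩
  have hXc : IsCompact (frontier S ∩ Metric.closedBall p ε) :=
    hfc.inter_right Metric.isClosed_closedBall
  have hCsub : ∀ n, C n ⊆ frontier S ∩ Metric.closedBall p ε := fun n =>
    connectedComponentIn_subset _ _
  have hCc : ∀ n, IsCompact (C n) := fun n => by
    refine hXc.of_isClosed_subset ?_ (hCsub n)
    refine isClosed_of_closure_subset ?_
    exact isPreconnected_connectedComponentIn.closure.subset_connectedComponentIn
      (subset_closure (mem_connectedComponentIn (hqX n)))
      (closure_minimal (hCsub n) hXc.isClosed)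
  have hCp : ∀ n, IsPreconnected (C n) := fun n => isPreconnected_connectedComponentIn
  have hqC : ∀ n, q n ∈ C n := fun n => mem_connectedComponentIn (hqX n)
  have hr : ∀ n, ∃ r ∈ C n, dist r p = ε := fun n =>
    tz_bump hfc hfp hp (hqf n) ((hqd n).trans_le (min_le_right _ _)) (hpq n)
  choose r hrC hrd using hr
  obtain ⟨r0, hr0, φ, hφ, hlim⟩ := hfc.tendsto_subseq (fun n => (hCsub n (hrC n)).1)
  have hr0d : dist r0 p = ε := by
    have h1 : Filter.Tendsto (fun n => dist (r (φ n)) p) Filter.atTop (𝓝 (dist r0 p)) :=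
      hlim.dist tendsto_const_nhds
    simp only [hrd] at h1
    exact tendsto_nhds_unique tendsto_const_nhds h1 |>.symm
  have hq : Filter.Tendsto q Filter.atTop (𝓝 p) := by
    rw [tendsto_iff_dist_tendsto_zero]
    exact squeeze_zero (fun _ => dist_nonneg)
      (fun n => ((hqd n).trans_le (min_le_left _ _)).le) tendsto_one_div_add_atTop_nhds_zero_nat
  have hq' : Filter.Tendsto (fun n => q (φ n)) Filter.atTop (𝓝 p) := hq.comp hφ.tendsto_atTop
  have hVW : Disjoint (Metric.ball p (ε / 2)) (Metric.ball r0 (ε / 2)) :=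
    Metric.ball_disjoint_ball (by rw [dist_comm, hr0d]; linarith)
  have evK : ∀ᶠ n in Filter.atTop, tzJ A (Metric.ball p (ε / 2)) p (q (φ n)) := by
    have := tzJ_local hA hl (Metric.isOpen_ball (x := p) (ε := ε / 2)) (hfA hp)
      (Metric.mem_ball_self (by linarith))
    exact (tendsto_nhdsWithin_iff.2 ⟨hq', Filter.Eventually.of_forall fun n => hfA (hqf _)⟩) this
  have evM : ∀ᶠ n in Filter.atTop, tzJ A (Metric.ball r0 (ε / 2)) r0 (r (φ n)) := by
    have := tzJ_local hA hl (Metric.isOpen_ball (x := r0) (ε := ε / 2)) (hfA hr0)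
      (Metric.mem_ball_self (by linarith))
    exact (tendsto_nhdsWithin_iff.2 ⟨hlim, Filter.Eventually.of_forall fun n =>
      hfA (hCsub _ (hrC _)).1⟩) this
  have evD : ∀ n, ∀ᶠ m in Filter.atTop, Disjoint (C n) (C (φ m)) := by
    intro n
    have : ∀ᶠ m in Filter.atTop, q (φ m) ∈ (C n)ᶜ :=
      hq' ((hCc n).isClosed.isOpen_compl.mem_nhds (hpq n))
    filter_upwards [this] with m hm
    rw [disjoint_left]
    intro z hz hz'
    apply hm
    have e1 : C n = connectedComponentIn _ z := connectedComponentIn_eq hz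
    have e2 : C (φ m) = connectedComponentIn _ z := connectedComponentIn_eq hz'
    rw [e1, ← e2]
    exact hqC _
  obtain ⟨n1, hn1⟩ := (evK.and evM).exists
  obtain ⟨n2, hn2, hd12⟩ := ((evK.and evM).and (evD (φ n1))).exists
  obtain ⟨n3, ⟨hn3, hd13⟩, hd23⟩ := (((evK.and evM).and (evD (φ n1))).and (evD (φ n2))).exists
  let N : Fin 3 → ℕ := ![φ n1, φ n2, φ n3]
  refine tz_three hA hl hS hSc hSA hfA (fun i => C (N i)) (fun i => hCc _) (fun i => hCp _)
    (fun i => (hCsub _).trans inter_subset_left) ?_ p r0 _ _ hVW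
    (fun i => ⟨q (N i), hqC _, ?_⟩) (fun i => ⟨r (N i), hrC _, ?_⟩)
  · intro i j hij
    fin_cases i <;> fin_cases j
    · exact absurd rfl hij
    · exact hd12
    · exact hd13
    · exact hd12.symm
    · exact absurd rfl hij
    · exact hd23
    · exact hd13.symm
    · exact hd23.symm
    · exact absurd rfl hij
  · fin_cases i
    · exact hn1.1
    · exact hn2.1
    · exact hn3.1
  · fin_cases i
    · exact hn1.2
    · exact hn2.2
    · exact hn3.2

/-- If `A ⊆ ℝ²` is a locally connected continuum and `S` is a connected
component of `ℝ² \ A`, then `∂S` is a locally connected continuum. -/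
theorem stmt4 (A : Set (ℝ × ℝ)) (hAcomp : IsCompact A) (hAconn : IsConnected A)
    (hAlc : LocallyConnectedSpace A)
    (S : Set (ℝ × ℝ)) (hS : ∃ x ∈ Aᶜ, S = connectedComponentIn Aᶜ x) :
    IsCompact (frontier S) ∧ IsConnected (frontier S) ∧
      LocallyConnectedSpace (frontier S) := by
  obtain ⟨x, hx, rfl⟩ := hS
  have hA := hAcomp.isClosed
  have hfA := tz_frontier_sub A hA x
  have hfc : IsCompact (frontier (connectedComponentIn Aᶜ x)) :=
    hAcomp.of_isClosed_subset isClosed_frontier hfA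
  have hfp := tz_frontier_conn A hA hAconn x
  refine ⟨hfc, ⟨tz_frontier_nonempty A hAconn.nonempty x hx, hfp⟩, ?_⟩
  have hSo : IsOpen (connectedComponentIn Aᶜ x) := hA.isOpen_compl.connectedComponentIn
  have hSc : IsConnected (connectedComponentIn Aᶜ x) := isConnected_connectedComponentIn_iff.2 hx
  have hSA : Disjoint (connectedComponentIn Aᶜ x) A :=
    disjoint_left.2 fun z hz => connectedComponentIn_subset _ _ hz
  have cik := @tz_cik A _ hA hAlc hSo hSc hSA hfA hfc hfp
  generalize frontier (connectedComponentIn Aᶜ x) = B at *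
  rw [locallyConnectedSpace_iff_connected_subsets]
  rintro ⟨p, hp⟩ U hU
  obtain ⟨ε, hε, hb⟩ := Metric.nhds_basis_closedBall.mem_iff.1 hU
  obtain ⟨δ, hδ, h⟩ := cik hp hε
  have hpX : p ∈ B ∩ Metric.closedBall p ε := ⟨hp, Metric.mem_closedBall_self hε.le⟩
  refine ⟨Subtype.val ⁻¹' connectedComponentIn (B ∩ Metric.closedBall p ε) p, ?_, ?_, ?_⟩
  · refine Filter.mem_of_superset (Metric.ball_mem_nhds _ hδ) ?_
    rintro ⟨q, hq⟩ hqd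
    have h1 := h q hq hqd
    change q ∈ connectedComponentIn _ p
    rw [← connectedComponentIn_eq h1]
    refine mem_connectedComponentIn ?_
    by_contra hqX
    rw [connectedComponentIn_eq_empty hqX] at h1
    exact h1
  · rw [← Topology.IsInducing.subtypeVal.isPreconnected_image, Subtype.image_preimage_coe,
      inter_eq_right.2 ((connectedComponentIn_subset _ _).trans inter_subset_left)]
    exact isPreconnected_connectedComponentIn
  · intro z hz
    exact hb (connectedComponentIn_subset _ _ hz).2
end

section
/- Let A ⊆ ℝ² be a locally connected continuum (a nonempty compact connected set that is locally connected as a subspace) such that ℝ² \ A has only finitely many connected components. Then the topological boundary ∂A of A in ℝ² is locally connected as a subspace of ℝ². -/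
open Set Topology

namespace Torh

lemma exists_log {f : ℂ → ℂ} (hf : Continuous f) (h0 : ∀ z, f z ≠ 0) :
    ∃ g : ℂ → ℂ, Continuous g ∧ ∀ z, Complex.exp (g z) = f z := by
  obtain ⟨g, ⟨-, hg⟩, -⟩ := Complex.isCoveringMapOn_exp.existsUnique_continuousMap_lifts
    (⟨f, hf⟩ : C(ℂ, ℂ)) (a₀ := 0) (e₀ := Complex.log (f 0)) (Complex.exp_log (h0 0))
    (fun a => h0 a)
  exact ⟨g, g.continuous, fun z => congrFun hg z⟩

lemma exp_one_small {x : ℂ} (h : Complex.exp x = 1) (hx : ‖x‖ < 1) : x = 0 := by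
  obtain ⟨n, hn⟩ := Complex.exp_eq_one_iff.1 h
  by_cases h0 : n = 0
  · simp [hn, h0]
  · exfalso
    have h1 : (1 : ℝ) ≤ |(n : ℝ)| := by exact_mod_cast Int.one_le_abs h0
    have h2 : ‖x‖ = |(n : ℝ)| * (2 * Real.pi) := by
      rw [hn]; simp [abs_of_pos Real.pi_pos]
    have := Real.pi_gt_three
    nlinarith

lemma const_of_exp {α : Type*} [TopologicalSpace α] {C : Set α} (hC : IsPreconnected C)
    {g : α → ℂ} (hg : ContinuousOn g C) (h1 : ∀ z ∈ C, Complex.exp (g z) = 1)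
    {x y : α} (hx : x ∈ C) (hy : y ∈ C) : g x = g y := by
  refine hC.induction₂ (fun x y => g x = g y) ?_ (fun _ _ _ _ _ _ h h' => h.trans h')
    (fun _ _ _ _ h => h.symm) hx hy
  intro x hx
  have := (Metric.tendsto_nhds.1 (hg x hx)) 1 one_pos
  filter_upwards [this, self_mem_nhdsWithin] with y hy hyC
  have := exp_one_small (x := g y - g x) (by rw [Complex.exp_sub, h1 y hyC, h1 x hx, div_one])
    (by rwa [← dist_eq_norm])
  exact (sub_eq_zero.1 this).symm

lemma mv {p q : ℂ} {R : ℝ} (hR : 0 < R) {E F : Set ℂ} (hE : IsClosed E) (hF : IsClosed F)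
    (hEF : E ∪ F = Metric.closedBall p R) {C₁ C₂ : Set ℂ} (hC₁ : IsPreconnected C₁)
    (hC₂ : IsPreconnected C₂) (h₁ : C₁ ⊆ E) (h₂ : C₂ ⊆ F) (hp₁ : p ∈ C₁) (hq₁ : q ∈ C₁)
    (hp₂ : p ∈ C₂) (hq₂ : q ∈ C₂) : q ∈ connectedComponentIn (E ∩ F) p := by
  classical
  have hcE : IsCompact E := (isCompact_closedBall p R).of_isClosed_subset hE
    (hEF ▸ subset_union_left)
  have hcT : IsCompact (E ∩ F) := hcE.inter_right hF
  have hp : p ∈ E ∩ F := ⟨h₁ hp₁, h₂ hp₂⟩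
  have hq : q ∈ E ∩ F := ⟨h₁ hq₁, h₂ hq₂⟩
  by_contra hcon
  have : CompactSpace (E ∩ F : Set ℂ) := isCompact_iff_compactSpace.1 hcT
  rw [connectedComponentIn_eq_image hp] at hcon
  have hcon' : (⟨q, hq⟩ : (E ∩ F : Set ℂ)) ∉ connectedComponent ⟨p, hp⟩ :=
    fun h => hcon ⟨_, h, rfl⟩
  rw [connectedComponent_eq_iInter_isClopen] at hcon'
  simp only [mem_iInter, not_forall] at hcon'
  obtain ⟨⟨s, hs, hps⟩, hqs⟩ := hcon'
  have hemb := hcT.isClosed.isClosedEmbedding_subtypeVal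
  obtain ⟨u, hu0, hu1, -⟩ := exists_continuous_zero_one_of_isClosed
    (hemb.isClosedMap s hs.1) (hemb.isClosedMap sᶜ hs.compl.1)
    ((disjoint_image_iff Subtype.val_injective).2 disjoint_compl_right)
  have hval : ∀ z ∈ E ∩ F, u z = 0 ∨ u z = 1 := by
    intro z hz
    by_cases h : (⟨z, hz⟩ : (E ∩ F : Set ℂ)) ∈ s
    · exact Or.inl (hu0 ⟨_, h, rfl⟩)
    · exact Or.inr (hu1 ⟨_, h, rfl⟩)
  let e : ℂ → ℂ := fun z => 2 * Real.pi * Complex.I * (u z : ℂ)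
  have hec : Continuous e := by
    have := u.continuous
    fun_prop
  let φ : ℂ → ℂ := fun z => if z ∈ E then Complex.exp (e z) else 1
  have hφE : ∀ z ∈ E, φ z = Complex.exp (e z) := fun z hz => if_pos hz
  have hφF : ∀ z ∈ F, φ z = 1 := by
    intro z hz
    by_cases h : z ∈ E
    · rw [hφE z h]
      rcases hval z ⟨h, hz⟩ with h' | h' <;> simp [e, h', Complex.exp_two_pi_mul_I]
    · exact if_neg h
  have hφ : ContinuousOn φ (Metric.closedBall p R) := by
    rw [← hEF]
    refine ContinuousOn.union_of_isClosed ?_ ?_ hE hF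
    · exact (Complex.continuous_exp.comp hec).continuousOn.congr hφE
    · exact (continuousOn_const (c := (1 : ℂ))).congr hφF
  have hφ0 : ∀ z, φ z ≠ 0 := by
    intro z
    by_cases h : z ∈ E
    · rw [hφE z h]; exact Complex.exp_ne_zero _
    · simp [φ, h]
  let ρ : ℂ → ℂ := fun z => p + ((R / max R ‖z - p‖ : ℝ) : ℂ) * (z - p)
  have hmax : ∀ z, 0 < max R ‖z - p‖ := fun z => lt_max_of_lt_left hR
  have hρc : Continuous ρ := by
    have : Continuous fun z : ℂ => R / max R ‖z - p‖ :=
      continuous_const.div (by fun_prop) (fun z => (hmax z).ne')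
    fun_prop
  have hρm : ∀ z, ρ z ∈ Metric.closedBall p R := by
    intro z
    rw [Metric.mem_closedBall, dist_eq_norm]
    simp only [ρ, add_sub_cancel_left, norm_mul, Complex.norm_real, Real.norm_eq_abs]
    rw [abs_of_pos (div_pos hR (hmax z)), div_mul_eq_mul_div, div_le_iff₀ (hmax z)]
    exact mul_le_mul_of_nonneg_left (le_max_right _ _) hR.le
  have hρi : ∀ z ∈ Metric.closedBall p R, ρ z = z := by
    intro z hz
    rw [Metric.mem_closedBall, dist_eq_norm] at hz
    simp only [ρ]
    rw [max_eq_left hz, div_self hR.ne']; simp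
  obtain ⟨g, hg, hg'⟩ := exists_log (f := fun z => φ (ρ z))
    (hφ.comp_continuous hρc hρm) (fun z => hφ0 _)
  have hg'' : ∀ z ∈ Metric.closedBall p R, Complex.exp (g z) = φ z := by
    intro z hz; rw [hg' z, hρi z hz]
  have a₂ : g p = g q := const_of_exp hC₂ hg.continuousOn
    (fun z hz => by
      rw [hg'' z (hEF ▸ Or.inr (h₂ hz)), hφF z (h₂ hz)]) hp₂ hq₂
  have a₁ : g p - e p = g q - e q := const_of_exp (g := fun z => g z - e z) hC₁
    (hg.sub hec).continuousOn
    (fun z hz => by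
      rw [Complex.exp_sub, hg'' z (hEF ▸ Or.inl (h₁ hz)), hφE z (h₁ hz),
        div_self (Complex.exp_ne_zero _)]) hp₁ hq₁
  have b₁ : u p = 0 := hu0 ⟨_, hps, rfl⟩
  have b₂ : u q = 1 := hu1 ⟨_, hqs, rfl⟩
  rw [a₂] at a₁
  have : e p = e q := by linear_combination -a₁
  simp [e, b₁, b₂, Real.pi_ne_zero] at this

lemma log_ratio {W X : Set ℂ} (hWo : IsOpen W) (hW : IsPreconnected W) (hX : Disjoint X W)
    {u w : ℂ} (hu : u ∈ W) (hw : w ∈ W) :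
    ∃ g : ℂ → ℂ, ContinuousOn g X ∧ ∀ z ∈ X, Complex.exp (g z) * (z - u) = z - w := by
  have hne : ∀ z ∈ X, ∀ u ∈ W, z - u ≠ 0 := fun z hz u hu h =>
    disjoint_left.1 hX hz (by rwa [sub_eq_zero.1 h])
  refine hW.induction₂ (fun u w => ∃ g : ℂ → ℂ, ContinuousOn g X ∧
    ∀ z ∈ X, Complex.exp (g z) * (z - u) = z - w) ?_ ?_ ?_ hu hw
  · intro u hu
    obtain ⟨ε, hε, hb⟩ := Metric.isOpen_iff.1 hWo u hu
    filter_upwards [mem_nhdsWithin_of_mem_nhds (Metric.ball_mem_nhds u hε)] with y hy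
    have hmem : ∀ z ∈ X, 1 + (u - y) / (z - u) ∈ Complex.slitPlane := by
      intro z hz
      apply Complex.mem_slitPlane_of_norm_lt_one
      have h1 : ε ≤ ‖z - u‖ := by
        by_contra h
        exact disjoint_left.1 hX hz (hb (by rw [Metric.mem_ball, dist_eq_norm]; linarith))
      rw [norm_div, div_lt_one (by linarith), norm_sub_rev, ← dist_eq_norm]
      exact lt_of_lt_of_le hy h1
    refine ⟨fun z => Complex.log (1 + (u - y) / (z - u)), ?_, ?_⟩
    · refine ContinuousOn.clog ?_ hmem
      exact continuousOn_const.add (continuousOn_const.div (by fun_prop)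
        (fun z hz => hne z hz u hu))
    · intro z hz
      have := hne z hz u hu
      rw [Complex.exp_log (Complex.slitPlane_ne_zero (hmem z hz))]
      field_simp
      ring
  · rintro x y z hx hy hz ⟨g, hg, h⟩ ⟨g', hg', h'⟩
    refine ⟨fun z => g z + g' z, hg.add hg', fun t ht => ?_⟩
    rw [Complex.exp_add, ← h' t ht, ← h t ht]; ring
  · rintro x y hx hy ⟨g, hg, h⟩
    refine ⟨fun z => - g z, hg.neg, fun t ht => ?_⟩
    rw [Complex.exp_neg, ← h t ht, inv_mul_cancel_left₀ (Complex.exp_ne_zero _)]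

lemma log_out {W Y : Set ℂ} (hWo : IsOpen W) (hW : IsPreconnected W) (hY : Disjoint Y W)
    {p : ℂ} {b : ℝ} (hb : 0 < b) (hYb : Y ⊆ Metric.closedBall p b)
    {u w : ℂ} (hu : u ∈ W) (hw : w ∈ W) (hub : u ∉ Metric.closedBall p b) :
    ∃ g : ℂ → ℂ, ContinuousOn g Y ∧ ∀ z ∈ Y, Complex.exp (g z) = z - w := by
  obtain ⟨g, hg, h⟩ := log_ratio hWo hW hY hu hw
  rw [Metric.mem_closedBall, not_le, dist_comm, dist_eq_norm] at hub
  have hpu : p - u ≠ 0 := norm_pos_iff.1 (hb.trans hub)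
  have hmem : ∀ z ∈ Y, 1 + (z - p) / (p - u) ∈ Complex.slitPlane := by
    intro z hz
    apply Complex.mem_slitPlane_of_norm_lt_one
    rw [norm_div, div_lt_one (by linarith), ← dist_eq_norm]
    exact lt_of_le_of_lt (hYb hz) hub
  refine ⟨fun z => g z + (Complex.log (p - u) + Complex.log (1 + (z - p) / (p - u))), ?_, ?_⟩
  · refine hg.add (continuousOn_const.add (ContinuousOn.clog ?_ hmem))
    fun_prop
  · intro z hz
    rw [Complex.exp_add, Complex.exp_add, Complex.exp_log hpu,
      Complex.exp_log (Complex.slitPlane_ne_zero (hmem z hz)), ← h z hz]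
    congr 1
    field_simp
    ring

lemma no_log {W B : Set ℂ} (hWo : IsOpen W) (hWb : Bornology.IsBounded W) (hB : IsClosed B)
    (hfr : frontier W ⊆ B) {w : ℂ} (hw : w ∈ W) (n : ℤ) {k F : ℂ → ℂ}
    (hk : ContinuousOn k (closure W)) (hk0 : ∀ z ∈ closure W, k z ≠ 0)
    (hF : ContinuousOn F B)
    (h : ∀ z ∈ frontier W, Complex.exp (F z) = (z - w) ^ n * k z) : n = 0 := by
  classical
  obtain ⟨G, hG⟩ := ContinuousMap.exists_restrict_eq hB
    (⟨B.domRestrict F, continuousOn_iff_continuous_domRestrict.1 hF⟩ : C(B, ℂ))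
  have hGF : ∀ z ∈ B, G z = F z := fun z hz => DFunLike.congr_fun hG ⟨z, hz⟩
  have hne : ∀ z ∉ W, z - w ≠ 0 := fun z hz h => hz (by rwa [sub_eq_zero.1 h])
  have hfrW : ∀ z ∈ frontier W, z ∉ W := fun z hz h => by
    rw [hWo.frontier_eq] at hz; exact hz.2 h
  have hcl : closure {z | ¬ z ∈ W} = Wᶜ := (isClosed_compl_iff.2 hWo).closure_eq
  let H : ℂ → ℂ := fun z => if z ∈ W then k z else Complex.exp (G z) * ((z - w) ^ n)⁻¹
  have hH : Continuous H := by
    refine continuous_if ?_ hk ?_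
    · intro z hz
      have hz : z ∈ frontier W := hz
      have := zpow_ne_zero n (hne z (hfrW z hz))
      rw [hGF z (hfr hz), h z hz]
      field_simp
    · rw [hcl]
      refine (Complex.continuous_exp.comp G.continuous).continuousOn.mul (ContinuousOn.inv₀ ?_ ?_)
      · exact ContinuousOn.zpow₀ (by fun_prop) n (fun z hz => Or.inl (hne z hz))
      · exact fun z hz => zpow_ne_zero n (hne z hz)
  have hH0 : ∀ z, H z ≠ 0 := by
    intro z
    by_cases hz : z ∈ W
    · simpa [H, hz] using hk0 z (subset_closure hz)
    · have := zpow_ne_zero n (hne z hz)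
      simp [H, hz, Complex.exp_ne_zero, this]
  obtain ⟨L, hL, hL'⟩ := exists_log hH hH0
  obtain ⟨ρ, hρ0, hρ⟩ := hWb.subset_ball_lt 0 w
  have hc : ∀ t : ℝ, Complex.exp ((G (w + ρ * Complex.exp (t * Complex.I))
      - L (w + ρ * Complex.exp (t * Complex.I))) - n * (Real.log ρ + t * Complex.I)) = 1 := by
    intro t
    set z := w + ρ * Complex.exp (t * Complex.I) with hz
    have hzW : z ∉ W := fun h => by
      have := hρ h
      rw [Metric.mem_ball, dist_eq_norm, hz, add_sub_cancel_left, norm_mul,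
        Complex.norm_exp_ofReal_mul_I, Complex.norm_real, Real.norm_eq_abs, abs_of_pos hρ0] at this
      linarith
    have e1 : Complex.exp (Real.log ρ + t * Complex.I) = z - w := by
      rw [Complex.exp_add, ← Complex.ofReal_exp, Real.exp_log hρ0, hz]; ring
    have := zpow_ne_zero n (hne z hzW)
    rw [Complex.exp_sub, Complex.exp_sub, hL' z, Complex.exp_int_mul, e1]
    simp only [H, hzW, if_false]
    have := Complex.exp_ne_zero (G z)
    field_simp
  have key := const_of_exp (C := (univ : Set ℝ)) isPreconnected_univ
    (g := fun t : ℝ => (G (w + ρ * Complex.exp (t * Complex.I))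
      - L (w + ρ * Complex.exp (t * Complex.I))) - n * (Real.log ρ + t * Complex.I))
    (by
      have := G.continuous
      apply Continuous.continuousOn
      fun_prop) (fun t _ => hc t) (mem_univ 0) (mem_univ (2 * Real.pi))
  simpa [Complex.exp_two_pi_mul_I] using key

/-- Pointwise metric form of local connectedness (connected im kleinen). -/
def LC (A : Set ℂ) : Prop := ∀ x ∈ A, ∀ ε > 0, ∃ δ > 0, ∀ y ∈ A, dist y x < δ →
  ∃ V ⊆ A ∩ Metric.ball x ε, IsPreconnected V ∧ x ∈ V ∧ y ∈ V

lemma lc_of {A : Set ℂ} (h : LocallyConnectedSpace A) : LC A := by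
  intro x hx ε hε
  obtain ⟨V, hV, hVc, hVs⟩ := locallyConnectedSpace_iff_connected_subsets.1 h ⟨x, hx⟩
    (Metric.ball ⟨x, hx⟩ ε) (Metric.ball_mem_nhds _ hε)
  obtain ⟨δ, hδ, hb⟩ := Metric.mem_nhds_iff.1 hV
  refine ⟨δ, hδ, fun y hy hyd => ⟨Subtype.val '' V, ?_, ?_, ?_, ?_⟩⟩
  · rintro _ ⟨z, hz, rfl⟩
    exact ⟨z.2, hVs hz⟩
  · exact hVc.image _ continuous_subtype_val.continuousOn
  · exact ⟨⟨x, hx⟩, mem_of_mem_nhds hV, rfl⟩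
  · exact ⟨⟨y, hy⟩, hb hyd, rfl⟩

lemma of_lc {A : Set ℂ} (h : LC A) : LocallyConnectedSpace A := by
  rw [locallyConnectedSpace_iff_connected_subsets]
  rintro ⟨x, hx⟩ U hU
  obtain ⟨ε, hε, hb⟩ := Metric.mem_nhds_iff.1 hU
  obtain ⟨δ, hδ, hd⟩ := h x hx ε hε
  refine ⟨connectedComponentIn (Metric.ball ⟨x, hx⟩ ε) ⟨x, hx⟩, ?_,
    isPreconnected_connectedComponentIn, (connectedComponentIn_subset _ _).trans hb⟩
  refine Filter.mem_of_superset (Metric.ball_mem_nhds _ hδ) ?_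
  rintro ⟨y, hy⟩ hyd
  obtain ⟨V, hVs, hVc, hxV, hyV⟩ := hd y hy hyd
  have hV' : IsPreconnected (Subtype.val ⁻¹' V : Set A) := by
    rw [← Topology.IsInducing.subtypeVal.isPreconnected_image, Subtype.image_preimage_coe,
      inter_eq_right.2 (fun z hz => (hVs hz).1)]
    exact hVc
  have hy' : (⟨y, hy⟩ : A) ∈ (Subtype.val ⁻¹' V : Set A) := hyV
  exact hV'.subset_connectedComponentIn (x := ⟨x, hx⟩) hxV (fun z hz => (hVs hz).2) hy'

lemma closure_comp {G : Set ℂ} (hG : IsOpen G) {w z : ℂ}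
    (hz : z ∈ closure (connectedComponentIn G w)) (hzG : z ∈ G) :
    z ∈ connectedComponentIn G w := by
  have ho : IsOpen (connectedComponentIn G z) := hG.connectedComponentIn
  obtain ⟨y, hy1, hy2⟩ := mem_closure_iff.1 hz _ ho (mem_connectedComponentIn hzG)
  rw [connectedComponentIn_eq hy2, ← connectedComponentIn_eq hy1]
  exact mem_connectedComponentIn hzG

lemma fin_big {A : Set ℂ} (hA : IsCompact A) (hlc : LC A) {p : ℂ} {r b R : ℝ} (hr : 0 < r)
    (hrb : r < b) (hbR : b < R) :
    {W : Set ℂ | ∃ w ∈ Metric.ball p r \ A, W = connectedComponentIn (Metric.ball p R \ A) w ∧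
      ¬ W ⊆ Metric.closedBall p b}.Finite := by
  classical
  by_contra hinf
  have hinf : Set.Infinite _ := hinf
  set 𝒲 := {W : Set ℂ | ∃ w ∈ Metric.ball p r \ A,
    W = connectedComponentIn (Metric.ball p R \ A) w ∧ ¬ W ⊆ Metric.closedBall p b} with h𝒲
  set G := Metric.ball p R \ A with hGdef
  have hG : IsOpen G := Metric.isOpen_ball.sdiff hA.isClosed
  let ι := hinf.natEmbedding
  let W : ℕ → Set ℂ := fun i => (ι i : Set ℂ)
  have hWi : Function.Injective W := Subtype.val_injective.comp ι.injective
  have hW : ∀ i, ∃ w ∈ Metric.ball p r \ A, W i = connectedComponentIn G w ∧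
    ¬ W i ⊆ Metric.closedBall p b := fun i => (ι i).2
  choose w hwm hWw hWb using hW
  have hwG : ∀ i, w i ∈ G := fun i =>
    ⟨Metric.ball_subset_ball (by linarith) (hwm i).1, (hwm i).2⟩
  have hwW : ∀ i, w i ∈ W i := fun i => by rw [hWw]; exact mem_connectedComponentIn (hwG i)
  have hWo : ∀ i, IsOpen (W i) := fun i => by rw [hWw]; exact hG.connectedComponentIn
  have hWc : ∀ i, IsPreconnected (W i) := fun i => by
    rw [hWw]; exact isPreconnected_connectedComponentIn
  have hWG : ∀ i, W i ⊆ G := fun i => by rw [hWw]; exact connectedComponentIn_subset _ _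
  have hdisj : ∀ i j, i ≠ j → w i ∉ closure (W j) := by
    intro i j hij h
    rw [hWw j] at h
    have := closure_comp hG h (hwG i)
    apply hij
    apply hWi
    rw [hWw i, hWw j, connectedComponentIn_eq this]
  set s := (r + b) / 2 with hs
  set X := ((A ∪ Metric.sphere p R) ∩ Metric.closedBall p R) ∩ (Metric.ball p r)ᶜ with hX
  set Y := A ∩ Metric.closedBall p b with hY
  -- logs
  have hf : ∀ i, ∃ f : ℂ → ℂ, ContinuousOn f X ∧
      ∀ z ∈ X, Complex.exp (f z) * (z - w 0) = z - w (i + 1) := fun i =>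
    log_ratio Metric.isOpen_ball (convex_ball p r).isPreconnected
      (disjoint_left.2 fun z hz => hz.2) (hwm 0).1 (hwm (i + 1)).1
  have hg : ∀ i, ∃ g : ℂ → ℂ, ContinuousOn g Y ∧ ∀ z ∈ Y, Complex.exp (g z) = z - w i := by
    intro i
    obtain ⟨u, hu, hub⟩ := not_subset.1 (hWb i)
    exact log_out (hWo i) (hWc i) (disjoint_left.2 fun z hz hz' => (hWG i hz').2 hz.1)
      (hr.trans hrb) inter_subset_right hu (hwW i) hub
  choose f hfc hfe using hf
  choose g hgc hge using hg
  have hAne : ∀ z ∈ A ∪ Metric.sphere p R, ∀ i, z - w i ≠ 0 := by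
    intro z hz i h
    rw [sub_eq_zero.1 h] at hz
    rcases hz with hz | hz
    · exact (hwG i).2 hz
    · have := (hwG i).1
      rw [Metric.mem_ball] at this
      rw [Metric.mem_sphere] at hz
      linarith
  let e : ℕ → ℂ → ℂ := fun i z => f i z - (g (i + 1) z - g 0 z)
  have he : ∀ i, ContinuousOn (e i) (X ∩ Y) := fun i =>
    ((hfc i).mono inter_subset_left).sub
      (((hgc _).mono inter_subset_right).sub ((hgc _).mono inter_subset_right))
  have he1 : ∀ i, ∀ z ∈ X ∩ Y, Complex.exp (e i z) = 1 := by
    intro i z hz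
    have h0 := hAne z (Or.inl hz.2.1) 0
    have h1 := hAne z (Or.inl hz.2.1) (i + 1)
    simp only [e]
    rw [Complex.exp_sub, Complex.exp_sub, hge _ z hz.2, hge _ z hz.2, ← hfe i z hz.1]
    have := Complex.exp_ne_zero (f i z)
    field_simp
  -- finite cover
  have hcomp : IsCompact (A ∩ Metric.sphere p s) := hA.inter_right Metric.isClosed_sphere
  have hε : 0 < (b - r) / 2 := by linarith
  have hcov : ∀ x : ℂ, ∃ δ > 0, x ∈ A → ∀ y ∈ A, dist y x < δ →
      ∃ V ⊆ A ∩ Metric.ball x ((b - r) / 2), IsPreconnected V ∧ x ∈ V ∧ y ∈ V := by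
    intro x
    by_cases hx : x ∈ A
    · obtain ⟨δ, hδ, h⟩ := hlc x hx _ hε
      exact ⟨δ, hδ, fun _ => h⟩
    · exact ⟨1, one_pos, fun h => absurd h hx⟩
  choose δ hδ hδV using hcov
  obtain ⟨t, htm, hts⟩ := hcomp.elim_nhds_subcover (fun x => Metric.ball x (δ x))
    (fun x _ => Metric.ball_mem_nhds x (hδ x))
  have hXY : ∀ z ∈ A, r ≤ dist z p → dist z p ≤ b → z ∈ X ∩ Y := by
    intro z hz h1 h2
    refine ⟨⟨⟨Or.inl hz, ?_⟩, ?_⟩, hz, h2⟩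
    · exact (h2.trans hbR.le : dist z p ≤ R)
    · simpa using h1
  have hSXY : ∀ z ∈ A, dist z p = s → z ∈ X ∩ Y := fun z hz h =>
    hXY z hz (by linarith) (by linarith)
  have hd : ∀ i : ℕ, ∀ x : t, ∃ d : ℤ, e i x = d * (2 * Real.pi * Complex.I) := fun i x =>
    Complex.exp_eq_one_iff.1 (he1 i x (hSXY x (htm x x.2).1 (htm x x.2).2))
  choose d hd using hd
  have hnl : ¬ LinearIndependent ℤ (fun i : Fin (t.card + 1) => d i) := by
    intro h
    have := h.fintype_card_le_finrank
    simp at this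
  obtain ⟨c, hc, i₀, hi₀⟩ := Fintype.not_linearIndependent_iff.1 hnl
  have hct : ∀ x : t, ∑ i, (c i : ℂ) * e i x = 0 := by
    intro x
    have h1 := congrFun hc x
    simp only [Finset.sum_apply, Pi.smul_apply, smul_eq_mul, Pi.zero_apply] at h1
    have h2 : ∑ i, (c i : ℂ) * (d i x : ℂ) = 0 := by exact_mod_cast h1
    simp_rw [hd, ← mul_assoc, ← Finset.sum_mul]
    simp [h2]
  have hcS : ∀ z ∈ A, dist z p = s → ∑ i, (c i : ℂ) * e i z = 0 := by
    intro z hz hzs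
    obtain ⟨x, hxt, hzx⟩ := mem_iUnion₂.1 (hts ⟨hz, hzs⟩)
    have hxs : dist x p = s := (htm x hxt).2
    obtain ⟨V, hV, hVc, hxV, hzV⟩ := hδV x (htm x hxt).1 z hz hzx
    have hVXY : V ⊆ X ∩ Y := by
      intro y hy
      have h1 : dist y x < (b - r) / 2 := (hV hy).2
      have h2 := dist_triangle y x p
      have h3 := dist_triangle_left x p y
      rw [hxs] at h2 h3
      exact hXY y (hV hy).1 (by linarith) (by linarith)
    rw [← hct ⟨x, hxt⟩]
    refine Finset.sum_congr rfl fun i _ => ?_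
    rw [const_of_exp hVc ((he i).mono hVXY) (fun y hy => he1 i y (hVXY hy)) hzV hxV]
  -- glue
  let Ff : ℂ → ℂ := fun z => ∑ i : Fin (t.card + 1), (c i : ℂ) * f i z
  let Fg : ℂ → ℂ := fun z => ∑ i : Fin (t.card + 1), (c i : ℂ) * (g (i + 1) z - g 0 z)
  let F : ℂ → ℂ := fun z => if dist z p ≤ s then Fg z else Ff z
  set B₁ := Y ∩ {z | dist z p ≤ s} with hB₁
  set B₂ := X ∩ {z | s ≤ dist z p} with hB₂
  have hdc : Continuous fun z : ℂ => dist z p := by fun_prop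
  have hYcl : IsClosed Y := hA.isClosed.inter Metric.isClosed_closedBall
  have hXcl : IsClosed X := ((hA.isClosed.union Metric.isClosed_sphere).inter
    Metric.isClosed_closedBall).inter Metric.isOpen_ball.isClosed_compl
  have hB₁c : IsClosed B₁ := hYcl.inter (isClosed_le hdc continuous_const)
  have hB₂c : IsClosed B₂ := hXcl.inter (isClosed_le continuous_const hdc)
  have hF1 : ∀ z ∈ B₁, F z = Fg z := fun z hz => if_pos hz.2
  have hF2 : ∀ z ∈ B₂, F z = Ff z := by
    intro z hz
    by_cases h : dist z p ≤ s
    · have hzs : dist z p = s := le_antisymm h hz.2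
      have hzA : z ∈ A := by
        rcases hz.1.1.1 with h' | h'
        · exact h'
        · rw [Metric.mem_sphere] at h'; linarith
      have := hcS z hzA hzs
      simp only [F, if_pos h]
      rw [eq_comm, ← sub_eq_zero, ← this, ← Finset.sum_sub_distrib]
      exact Finset.sum_congr rfl fun i _ => by simp only [e]; ring
    · exact if_neg h
  have hFc : ContinuousOn F (B₁ ∪ B₂) := by
    refine ContinuousOn.union_of_isClosed ?_ ?_ hB₁c hB₂c
    · refine ContinuousOn.congr ?_ hF1
      refine continuousOn_finset_sum _ fun i _ => continuousOn_const.mul ?_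
      exact ((hgc _).sub (hgc _)).mono inter_subset_left
    · refine ContinuousOn.congr ?_ hF2
      refine continuousOn_finset_sum _ fun i _ => continuousOn_const.mul ?_
      exact (hfc _).mono inter_subset_left
  let q : Fin (t.card + 1) → ℂ → ℂ := fun i z => ((z - w (i + 1)) / (z - w 0)) ^ (c i)
  have hFe : ∀ z ∈ B₁ ∪ B₂, Complex.exp (F z) = ∏ i, q i z := by
    rintro z (hz | hz)
    · rw [hF1 z hz, Complex.exp_sum]
      refine Finset.prod_congr rfl fun i _ => ?_
      rw [Complex.exp_int_mul, Complex.exp_sub, hge _ z hz.1, hge _ z hz.1]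
    · rw [hF2 z hz, Complex.exp_sum]
      refine Finset.prod_congr rfl fun i _ => ?_
      have := hAne z hz.1.1.1 0
      rw [Complex.exp_int_mul, eq_div_of_mul_eq this (hfe i z hz.1)]
  have hfr : frontier (W (i₀ + 1)) ⊆ B₁ ∪ B₂ := by
    intro z hz
    rw [(hWo _).frontier_eq] at hz
    have hzR : dist z p ≤ R := by
      have := closure_mono ((hWG _).trans diff_subset) hz.1
      exact Metric.closure_ball_subset_closedBall this
    have hzA : z ∈ A ∪ Metric.sphere p R := by
      by_contra h
      rw [mem_union, not_or, Metric.mem_sphere] at h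
      apply hz.2
      have h1 := hz.1
      rw [hWw] at h1 ⊢
      exact closure_comp hG h1 ⟨lt_of_le_of_ne hzR h.2, h.1⟩
    by_cases h : dist z p ≤ s
    · left
      refine ⟨⟨?_, ?_⟩, h⟩
      · rcases hzA with h' | h'
        · exact h'
        · rw [Metric.mem_sphere] at h'; linarith
      · rw [Metric.mem_closedBall]; linarith
    · right
      rw [not_le] at h
      refine ⟨⟨⟨hzA, hzR⟩, ?_⟩, h.le⟩
      rw [mem_compl_iff, Metric.mem_ball]; linarith
  have hcl0 : ∀ z ∈ closure (W (i₀ + 1)), z - w 0 ≠ 0 := fun z hz h =>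
    hdisj 0 (i₀ + 1) (by omega) (by rwa [← sub_eq_zero.1 h])
  have hcli : ∀ i : Fin (t.card + 1), i ≠ i₀ → ∀ z ∈ closure (W (i₀ + 1)), z - w (i + 1) ≠ 0 :=
    fun i hi z hz h => hdisj (i + 1) (i₀ + 1) (fun h => hi (Fin.ext (by omega)))
      (by rwa [← sub_eq_zero.1 h])
  refine hi₀ (no_log (hWo (i₀ + 1)) (Metric.isBounded_ball.subset ((hWG _).trans diff_subset))
    (hB₁c.union hB₂c) hfr (hwW _) (c i₀)
    (k := fun z => ((z - w 0) ^ (c i₀))⁻¹ * ∏ i ∈ Finset.univ.erase i₀, q i z) ?_ ?_ hFc ?_)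
  · refine ContinuousOn.mul (ContinuousOn.inv₀ ?_ ?_) (continuousOn_finset_prod _ ?_)
    · exact ContinuousOn.zpow₀ (by fun_prop) _ (fun z hz => Or.inl (hcl0 z hz))
    · exact fun z hz => zpow_ne_zero _ (hcl0 z hz)
    · intro i hi
      have hi := Finset.ne_of_mem_erase hi
      refine ContinuousOn.zpow₀ (ContinuousOn.div (by fun_prop) (by fun_prop) hcl0) _ ?_
      exact fun z hz => Or.inl (div_ne_zero (hcli i hi z hz) (hcl0 z hz))
  · intro z hz
    refine mul_ne_zero (inv_ne_zero (zpow_ne_zero _ (hcl0 z hz))) (Finset.prod_ne_zero_iff.2 ?_)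
    intro i hi
    have hi := Finset.ne_of_mem_erase hi
    exact zpow_ne_zero _ (div_ne_zero (hcli i hi z hz) (hcl0 z hz))
  · intro z hz
    rw [hFe z (hfr hz), ← Finset.mul_prod_erase _ _ (Finset.mem_univ i₀)]
    simp only [q, div_zpow]
    ring

lemma fin_all {A : Set ℂ} (hA : IsCompact A) (hlc : LC A)
    (hfin : {C : Set ℂ | ∃ x ∈ Aᶜ, C = connectedComponentIn Aᶜ x}.Finite)
    {p : ℂ} {r R : ℝ} (hr : 0 < r) (hrR : r < R) :
    {W : Set ℂ | ∃ w ∈ Metric.ball p r \ A,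
      W = connectedComponentIn (Metric.ball p R \ A) w}.Finite := by
  refine ((fin_big hA hlc (p := p) (R := R) hr (b := (r + R) / 2) (by linarith)
    (by linarith)).union hfin).subset ?_
  rintro W ⟨w, hw, rfl⟩
  have hG : IsOpen (Metric.ball p R \ A) := Metric.isOpen_ball.sdiff hA.isClosed
  by_cases h : connectedComponentIn (Metric.ball p R \ A) w ⊆ Metric.closedBall p ((r + R) / 2)
  · right
    refine ⟨w, hw.2, Subset.antisymm (connectedComponentIn_mono _ fun z hz => hz.2) ?_⟩
    refine isPreconnected_connectedComponentIn.subset_of_closure_inter_subset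
      hG.connectedComponentIn ⟨w, mem_connectedComponentIn hw.2, mem_connectedComponentIn
        ⟨Metric.ball_subset_ball hrR.le hw.1, hw.2⟩⟩ ?_
    rintro z ⟨hz, hz'⟩
    refine closure_comp hG hz ⟨?_, connectedComponentIn_subset _ _ hz'⟩
    have h1 : dist z p ≤ (r + R) / 2 := closure_minimal h Metric.isClosed_closedBall hz
    rw [Metric.mem_ball]; linarith
  · left
    exact ⟨w, hw, rfl, h⟩

lemma main {A : Set ℂ} (hA : IsCompact A) (hlc : LC A)
    (hfin : {C : Set ℂ | ∃ x ∈ Aᶜ, C = connectedComponentIn Aᶜ x}.Finite) :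
    LC (frontier A) := by
  intro p hp ε hε
  set R := ε / 2 with hR
  have hR0 : 0 < R := by linarith
  have hr0 : 0 < R / 2 := by linarith
  have hpA : p ∈ A := hA.isClosed.frontier_subset hp
  obtain ⟨δ₁, hδ₁, h₁⟩ := hlc p hpA R hR0
  have hf := fin_all hA hlc hfin (p := p) hr0 (by linarith : R / 2 < R)
  set 𝒲 := {W : Set ℂ | ∃ w ∈ Metric.ball p (R / 2) \ A,
      W = connectedComponentIn (Metric.ball p R \ A) w} with h𝒲
  have hbad : IsClosed (⋃ W ∈ {W ∈ 𝒲 | p ∉ closure W}, closure W) :=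
    (hf.subset (sep_subset _ _)).isClosed_biUnion fun _ _ => isClosed_closure
  have hpbad : p ∈ (⋃ W ∈ {W ∈ 𝒲 | p ∉ closure W}, closure W)ᶜ := by
    simp only [mem_compl_iff, mem_iUnion, not_exists]
    exact fun W hW h => hW.2 h
  obtain ⟨δ₂, hδ₂, h₂⟩ := Metric.isOpen_iff.1 hbad.isOpen_compl p hpbad
  refine ⟨min δ₁ (min δ₂ (R / 2)), by positivity, fun q hq hqp => ?_⟩
  simp only [lt_min_iff] at hqp
  obtain ⟨hq1, hq2, hq3⟩ := hqp
  have hqA : q ∈ A := hA.isClosed.frontier_subset hq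
  obtain ⟨V, hV, hVc, hpV, hqV⟩ := h₁ q hqA hq1
  have hqcl : q ∈ closure Aᶜ := by
    rw [frontier_eq_closure_inter_closure] at hq; exact hq.2
  have hqU : q ∈ closure (⋃ W ∈ 𝒲, W) := by
    have : q ∈ closure (Metric.ball p (R / 2) ∩ Aᶜ) :=
      Metric.isOpen_ball.inter_closure ⟨hq3, hqcl⟩
    refine closure_mono ?_ this
    rintro z ⟨hz, hzA⟩
    exact mem_iUnion₂.2 ⟨_, ⟨z, ⟨hz, hzA⟩, rfl⟩, mem_connectedComponentIn
      ⟨Metric.ball_subset_ball (by linarith) hz, hzA⟩⟩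
  rw [hf.closure_biUnion] at hqU
  obtain ⟨W, hW, hqW⟩ := mem_iUnion₂.1 hqU
  have hpW : p ∈ closure W := by
    by_contra h
    exact h₂ hq2 (mem_iUnion₂.2 ⟨W, ⟨hW, h⟩, hqW⟩)
  have hWsub : W ⊆ Metric.ball p R \ A := by
    obtain ⟨w, -, rfl⟩ := hW; exact connectedComponentIn_subset _ _
  have hWc : IsPreconnected W := by
    obtain ⟨w, -, rfl⟩ := hW; exact isPreconnected_connectedComponentIn
  have key : q ∈ connectedComponentIn ((A ∩ Metric.closedBall p R) ∩
      (closure Aᶜ ∩ Metric.closedBall p R)) p := by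
    refine mv (R := R) hR0 (hA.isClosed.inter Metric.isClosed_closedBall)
      (isClosed_closure.inter Metric.isClosed_closedBall) ?_ hVc hWc.closure ?_ ?_ hpV hqV hpW hqW
    · rw [← union_inter_distrib_right, inter_eq_right]
      intro z _
      by_cases h : z ∈ A
      · exact Or.inl h
      · exact Or.inr (subset_closure h)
    · exact fun z hz => ⟨(hV hz).1, Metric.ball_subset_closedBall (hV hz).2⟩
    · intro z hz
      exact ⟨closure_mono (fun y hy => (hWsub hy).2) hz,
        Metric.closure_ball_subset_closedBall (closure_mono (hWsub.trans diff_subset) hz)⟩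
  refine ⟨_, ?_, isPreconnected_connectedComponentIn, ?_, key⟩
  · refine (connectedComponentIn_subset _ _).trans ?_
    rintro z ⟨⟨hz1, hz2⟩, hz3, -⟩
    refine ⟨?_, ?_⟩
    · rw [frontier_eq_closure_inter_closure]; exact ⟨subset_closure hz1, hz3⟩
    · rw [Metric.mem_closedBall] at hz2
      rw [Metric.mem_ball]; linarith
  · refine mem_connectedComponentIn ⟨⟨hpA, Metric.mem_closedBall_self hR0.le⟩, ?_,
      Metric.mem_closedBall_self hR0.le⟩
    rw [frontier_eq_closure_inter_closure] at hp; exact hp.2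

end Torh

/-- If `A ⊆ ℝ²` is a locally connected continuum such that `ℝ² \ A` has
finitely many connected components, then `∂A` is locally connected as a subspace. -/
theorem stmt5 (A : Set (ℝ × ℝ)) (hAcomp : IsCompact A) (hAconn : IsConnected A)
    (hAlc : LocallyConnectedSpace A)
    (hfin : {C : Set (ℝ × ℝ) | ∃ x ∈ Aᶜ, C = connectedComponentIn Aᶜ x}.Finite) :
    LocallyConnectedSpace (frontier A) := by
  let e : ℝ × ℝ ≃ₜ ℂ := Complex.equivRealProdCLM.toHomeomorph.symm
  have h1 : LocallyConnectedSpace (e '' A) :=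
    (e.image A).symm.isOpenEmbedding.locallyConnectedSpace
  have h2 : {C : Set ℂ | ∃ x ∈ (e '' A)ᶜ, C = connectedComponentIn (e '' A)ᶜ x}.Finite := by
    refine (hfin.image (fun C => e '' C)).subset ?_
    rintro _ ⟨x, hx, rfl⟩
    rw [← e.image_compl] at hx ⊢
    obtain ⟨y, hy, rfl⟩ := hx
    exact ⟨_, ⟨y, hy, rfl⟩, e.image_connectedComponentIn hy⟩
  have h3 : LocallyConnectedSpace (frontier (e '' A)) :=
    Torh.of_lc (Torh.main (hAcomp.image e.continuous) (Torh.lc_of h1) h2)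
  rw [← e.image_frontier] at h3
  exact (e.image (frontier A)).isOpenEmbedding.locallyConnectedSpace
end

section
/- Let Y be a locally compact, second-countable metrizable space, and let f : ℝ² → Y be a function whose graph G = {(x, f x) : x ∈ ℝ²} is closed in ℝ² × Y, connected, and locally connected as a subspace of ℝ² × Y. Let D(f) be the set of points of ℝ² at which f is not continuous. Then the set {(x, f x) : x ∈ D(f)}, i.e., the graph of the restriction of f to D(f), is locally connected as a subspace of ℝ² × Y. -/
open Set Topology

def HasLog {K : Type*} [TopologicalSpace K] (F : K → ℂ) : Prop :=
  ∃ L : K → ℂ, Continuous L ∧ ∀ x, Complex.exp (L x) = F x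

lemma HasLog.step {K : Type*} [TopologicalSpace K] {F G : K → ℂ} (hF : Continuous F)
    (hG : Continuous G) (h0 : ∀ x, F x ≠ 0) (h : ∀ x, ‖G x / F x - 1‖ < 1) (hl : HasLog F) :
    HasLog G := by
  obtain ⟨L, hL, hLe⟩ := hl
  have hs : ∀ x, G x / F x ∈ Complex.slitPlane := by
    intro x
    have := Complex.mem_slitPlane_of_norm_lt_one (h x)
    simpa using this
  refine ⟨fun x => L x + Complex.log (G x / F x), ?_, ?_⟩
  · exact hL.add ((hG.div hF h0).clog hs)
  · intro x
    rw [Complex.exp_add, Complex.exp_log (Complex.slitPlane_ne_zero (hs x)), hLe]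
    field_simp [h0 x]

lemma HasLog.param {K P : Type*} [TopologicalSpace K] [CompactSpace K] [TopologicalSpace P]
    [PreconnectedSpace P] (F : P → K → ℂ) (hF : Continuous (Function.uncurry F))
    (h0 : ∀ p x, F p x ≠ 0) {p q : P} (hp : HasLog (F p)) : HasLog (F q) := by
  have hc : ∀ p, Continuous (F p) := fun p => hF.comp (by fun_prop : Continuous fun x => (p, x))
  have : IsLocallyConstant (fun p => HasLog (F p)) := by
    rw [IsLocallyConstant.iff_eventually_eq]
    intro p
    have key : ∀ᶠ p' in 𝓝 p, ∀ x ∈ (univ : Set K),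
        ‖F p' x / F p x - 1‖ < 1 ∧ ‖F p x / F p' x - 1‖ < 1 := by
      apply isCompact_univ.eventually_forall_of_forall_eventually
      intro x _
      have c1 : Continuous fun z : P × K => F z.1 z.2 := hF
      have c2 : Continuous fun z : P × K => F p z.2 := (hc p).comp continuous_snd
      apply Filter.Eventually.and
      · have : Continuous fun z : P × K => ‖F z.1 z.2 / F p z.2 - 1‖ :=
          ((c1.div c2 fun z => h0 _ _).sub continuous_const).norm
        apply this.continuousAt.eventually_lt continuousAt_const
        simp [h0]
      · have : Continuous fun z : P × K => ‖F p z.2 / F z.1 z.2 - 1‖ :=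
          ((c2.div c1 fun z => h0 _ _).sub continuous_const).norm
        apply this.continuousAt.eventually_lt continuousAt_const
        simp [h0]
    filter_upwards [key] with p' hp'
    apply propext
    exact ⟨HasLog.step (hc _) (hc _) (h0 _) fun x => (hp' x trivial).2,
      HasLog.step (hc _) (hc _) (h0 _) fun x => (hp' x trivial).1⟩
  have e := this.apply_eq_of_preconnectedSpace p q
  exact e ▸ hp

lemma HasLog.const {K : Type*} [TopologicalSpace K] {c : ℂ} (hc : c ≠ 0) :
    HasLog (fun _ : K => c) :=
  ⟨fun _ => Complex.log c, continuous_const, fun _ => Complex.exp_log hc⟩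

lemma HasLog.of_contractible {K : Type*} [TopologicalSpace K] [CompactSpace K]
    [ContractibleSpace K] (F : K → ℂ) (hF : Continuous F) (h0 : ∀ x, F x ≠ 0) : HasLog F := by
  obtain ⟨c, ⟨H⟩⟩ := id_nullhomotopic K
  have := HasLog.param (P := unitInterval) (fun t x => F (H (t, x)))
    (hF.comp (map_continuous H)) (fun _ _ => h0 _) (p := 1) (q := 0)
    (by simpa using HasLog.const (h0 c))
  simpa using this

lemma log_unique {X : Type*} [TopologicalSpace X] {S : Set X} (hS : IsPreconnected S)
    {g h : X → ℂ} (hg : ContinuousOn g S) (hh : ContinuousOn h S) (c : ℂ)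
    (he : ∀ x ∈ S, Complex.exp (g x) = c * Complex.exp (h x)) {x y : X} (hx : x ∈ S)
    (hy : y ∈ S) : g x - h x = g y - h y := by
  have h1 : ∀ z ∈ S, ∃ n : ℤ, g z - h z = g y - h y + n * (2 * Real.pi * Complex.I) := by
    intro z hz
    rw [← Complex.exp_eq_exp_iff_exists_int, Complex.exp_sub, Complex.exp_sub, he z hz, he y hy]
    field_simp [Complex.exp_ne_zero]
  set d : X → ℝ := fun z => ((g z - h z) - (g y - h y)).im / (2 * Real.pi) with hd
  have hdc : ContinuousOn d S := by
    apply ContinuousOn.div_const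
    exact Complex.continuous_im.comp_continuousOn ((hg.sub hh).sub continuousOn_const)
  have hpi := Real.pi_pos
  have hdm : MapsTo d S (Set.range (Int.cast : ℤ → ℝ)) := by
    intro z hz
    obtain ⟨n, hn⟩ := h1 z hz
    refine ⟨n, ?_⟩
    rw [hd]
    simp only [hn]
    simp
  have : DiscreteTopology (Set.range (Int.cast : ℤ → ℝ)) :=
    Int.isClosedEmbedding_coe_real.isEmbedding.toHomeomorph.symm.isEmbedding.discreteTopology
  have h2 := hS.constant_of_mapsTo ⟨this⟩ hdc hdm hx hy
  obtain ⟨n, hn⟩ := h1 x hx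
  have h3 : d x = n := by
    rw [hd]; simp only [hn]; simp
  have h4 : d y = 0 := by simp [hd]
  have : (n : ℝ) = 0 := by rw [← h3, h2, h4]
  have : n = 0 := by exact_mod_cast this
  rw [hn, this]; simp


lemma exists_continuousOn_log {E : Type*} [TopologicalSpace E] {K : Set E} {F : E → ℂ}
    (h : HasLog (K.domRestrict F)) :
    ∃ L : E → ℂ, ContinuousOn L K ∧ ∀ x ∈ K, Complex.exp (L x) = F x := by
  classical
  obtain ⟨L, hL, hLe⟩ := h
  have hr : K.domRestrict (fun x => if h : x ∈ K then L ⟨x, h⟩ else 0) = L := by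
    ext x
    simp
  refine ⟨fun x => if h : x ∈ K then L ⟨x, h⟩ else 0, ?_, ?_⟩
  · rw [continuousOn_iff_continuous_domRestrict, hr]
    exact hL
  · intro x hx
    simp only [hx, dif_pos, hLe]
    rfl

lemma exists_log_convex {E : Type*} [AddCommGroup E] [Module ℝ E] [TopologicalSpace E]
    [ContinuousAdd E] [ContinuousSMul ℝ E] {K : Set E} (hK : Convex ℝ K) (hc : IsCompact K)
    (hne : K.Nonempty) {F : E → ℂ} (hF : ContinuousOn F K) (h0 : ∀ x ∈ K, F x ≠ 0) :
    ∃ L : E → ℂ, ContinuousOn L K ∧ ∀ x ∈ K, Complex.exp (L x) = F x := by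
  have := hK.contractibleSpace hne
  have := isCompact_iff_compactSpace.1 hc
  apply exists_continuousOn_log
  exact HasLog.of_contractible _ (continuousOn_iff_continuous_domRestrict.1 hF) fun x => h0 _ x.2

lemma exists_log_ratio {K R : Set ℂ} (hK : IsCompact K) (hR : IsPreconnected R)
    (hd : Disjoint R K) {w y : ℂ} (hw : w ∈ R) (hy : y ∈ R) :
    ∃ L : ℂ → ℂ, ContinuousOn L K ∧ ∀ z ∈ K, Complex.exp (L z) = (z - w) / (z - y) := by
  have := isCompact_iff_compactSpace.1 hK
  have := isPreconnected_iff_preconnectedSpace.1 hR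
  have hne : ∀ (p : R) (z : K), (z : ℂ) - p ≠ 0 := by
    intro p z h
    exact Set.disjoint_left.1 hd p.2 (by rw [← sub_eq_zero.1 h]; exact z.2)
  apply exists_continuousOn_log
  have hp : HasLog (fun z : K => ((z : ℂ) - (⟨y, hy⟩ : R)) / ((z : ℂ) - (⟨y, hy⟩ : R))) := by
    have : (fun z : K => ((z : ℂ) - (⟨y, hy⟩ : R)) / ((z : ℂ) - (⟨y, hy⟩ : R))) = fun _ => 1 := by
      ext z
      exact div_self (hne ⟨y, hy⟩ z)
    rw [this]
    exact HasLog.const one_ne_zero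
  refine HasLog.param (P := R) (fun p (z : K) => ((z : ℂ) - p) / ((z : ℂ) - (⟨y, hy⟩ : R))) ?_ ?_
    (p := ⟨y, hy⟩) (q := ⟨w, hw⟩) hp
  · apply Continuous.div (by fun_prop) (by fun_prop)
    intro x
    exact hne _ _
  · intro p z
    exact div_ne_zero (hne _ _) (hne _ _)

lemma one_sub_slit {z : ℂ} (h : ‖z‖ < 1) : 1 - z ∈ Complex.slitPlane := by
  have := Complex.mem_slitPlane_of_norm_lt_one (z := -z) (by simpa using h)
  simpa [sub_eq_add_neg] using this

lemma norm_div_lt_one' {a b : ℂ} (h : ‖a‖ < ‖b‖) : ‖a / b‖ < 1 := by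
  rw [norm_div, div_lt_one (lt_of_le_of_lt (norm_nonneg _) h)]
  exact h

lemma exp_log_one_sub {a b : ℂ} (h : ‖a‖ < ‖b‖) :
    Complex.exp (Complex.log (1 - a / b)) = (b - a) / b := by
  rw [Complex.exp_log (Complex.slitPlane_ne_zero (one_sub_slit (norm_div_lt_one' h)))]
  have : b ≠ 0 := norm_pos_iff.1 (lt_of_le_of_lt (norm_nonneg _) h)
  field_simp

lemma contOn_log_one_sub {X : Type*} [TopologicalSpace X] {S : Set X} {a b : X → ℂ}
    (ha : ContinuousOn a S) (hb : ContinuousOn b S) (h : ∀ x ∈ S, ‖a x‖ < ‖b x‖) :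
    ContinuousOn (fun x => Complex.log (1 - a x / b x)) S := by
  apply ContinuousOn.clog
  · apply continuousOn_const.sub
    apply ha.div hb
    intro x hx
    exact norm_pos_iff.1 (lt_of_le_of_lt (norm_nonneg _) (h x hx))
  · intro x hx
    exact one_sub_slit (norm_div_lt_one' (h x hx))

lemma pair_odd {γi γj : ℝ → ℂ} (hci : Continuous γi) (hcj : Continuous γj) {s ρ τ : ℝ}
    (hρs : ρ < s) (hτ0 : 0 ≤ τ) (hτ1 : τ < 1)
    (hi1 : ‖γi 1‖ = s) (hil : ∀ t ∈ Ico (0:ℝ) 1, ‖γi t‖ < s) (hi0 : ‖γi 0‖ ≤ ρ)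
    (hiτ : ∀ t ∈ Icc τ 1, ρ < ‖γi t‖)
    (hj1 : ‖γj 1‖ = s) (hjl : ∀ t ∈ Ico (0:ℝ) 1, ‖γj t‖ < s) (hj0 : ‖γj 0‖ ≤ ρ)
    (hjτ : ∀ t ∈ Icc τ 1, ρ < ‖γj t‖)
    (hne : ∀ a ∈ Icc (0:ℝ) 1, ∀ b ∈ Icc (0:ℝ) 1, γj a ≠ γi b)
    {Gi Gj P P' : ℝ → ℂ} (hGi : ContinuousOn Gi (Icc τ 1)) (hGj : ContinuousOn Gj (Icc τ 1))
    (hGie : ∀ t ∈ Icc τ 1, Complex.exp (Gi t) = γi t)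
    (hGje : ∀ t ∈ Icc τ 1, Complex.exp (Gj t) = γj t)
    (hP : ContinuousOn P (Icc 0 1)) (hP' : ContinuousOn P' (Icc 0 1))
    (hPe : ∀ t ∈ Icc (0:ℝ) 1, Complex.exp (P t) = γj t - γi τ)
    (hPe' : ∀ t ∈ Icc (0:ℝ) 1, Complex.exp (P' t) = γi t - γj τ) :
    ∃ N : ℤ, (P 1 - P 0 - Complex.log (1 - γi τ / γj 1) + Complex.log (1 - γj 0 / γi τ))
      - (P' 1 - P' 0 - Complex.log (1 - γj τ / γi 1) + Complex.log (1 - γi 0 / γj τ))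
      + (Gi 1 + Gi τ) - (Gj 1 + Gj τ) = (2 * N + 1) * (2 * Real.pi * Complex.I) := by
  have m0 : (0:ℝ) ∈ Icc (0:ℝ) 1 := by simp
  have m1 : (1:ℝ) ∈ Icc (0:ℝ) 1 := by simp
  have mτ : τ ∈ Icc (0:ℝ) 1 := ⟨hτ0, hτ1.le⟩
  have n1 : (1:ℝ) ∈ Icc τ 1 := ⟨hτ1.le, le_rfl⟩
  have nτ : τ ∈ Icc τ 1 := ⟨le_rfl, hτ1.le⟩
  have l0 : (0:ℝ) ∈ Icc 0 τ := ⟨le_rfl, hτ0⟩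
  have lτ : τ ∈ Icc 0 τ := ⟨hτ0, le_rfl⟩
  have sub1 : Icc 0 τ ⊆ Icc (0:ℝ) 1 := Icc_subset_Icc le_rfl hτ1.le
  have sub2 : Icc τ 1 ⊆ Icc (0:ℝ) 1 := Icc_subset_Icc hτ0 le_rfl
  obtain ⟨φ, hφ, hφe⟩ := exists_log_convex (K := (Icc (0:ℝ) 1) ×ˢ (Icc (0:ℝ) 1))
    (F := fun x => γj x.1 - γi x.2) ((convex_Icc _ _).prod (convex_Icc _ _))
    (isCompact_Icc.prod isCompact_Icc) ⟨(0, 0), m0, m0⟩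
    (by fun_prop) (fun x hx => sub_ne_zero.2 (hne _ hx.1 _ hx.2))
  have slice1 : ∀ a ∈ Icc (0:ℝ) 1, ContinuousOn (fun t => φ (a, t)) (Icc 0 1) := fun a ha =>
    hφ.comp (by fun_prop) fun t ht => ⟨ha, ht⟩
  have slice2 : ∀ a ∈ Icc (0:ℝ) 1, ContinuousOn (fun t => φ (t, a)) (Icc 0 1) := fun a ha =>
    hφ.comp (by fun_prop) fun t ht => ⟨ht, ha⟩
  have e1 : P 1 - φ (1, τ) = P 0 - φ (0, τ) :=
    log_unique isPreconnected_Icc hP (slice2 τ mτ) 1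
      (fun x hx => by rw [hPe x hx, hφe (x, τ) ⟨hx, mτ⟩]; ring) m1 m0
  have e2 : P' 1 - φ (τ, 1) = P' 0 - φ (τ, 0) :=
    log_unique isPreconnected_Icc hP' (slice1 τ mτ) (-1)
      (fun x hx => by rw [hPe' x hx, hφe (τ, x) ⟨mτ, hx⟩]; ring) m1 m0
  have hil' : ∀ t ∈ Icc (0:ℝ) τ, ‖γi t‖ < ‖γj 1‖ := fun t ht => by
    rw [hj1]; exact hil t ⟨ht.1, ht.2.trans_lt hτ1⟩
  have hjl' : ∀ t ∈ Icc (0:ℝ) τ, ‖γj t‖ < ‖γi 1‖ := fun t ht => by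
    rw [hi1]; exact hjl t ⟨ht.1, ht.2.trans_lt hτ1⟩
  have hiτ' : ∀ t ∈ Icc τ 1, ‖γj 0‖ < ‖γi t‖ := fun t ht => hj0.trans_lt (hiτ t ht)
  have hjτ' : ∀ t ∈ Icc τ 1, ‖γi 0‖ < ‖γj t‖ := fun t ht => hi0.trans_lt (hjτ t ht)
  have nz : ∀ {a b : ℂ}, ‖a‖ < ‖b‖ → b ≠ 0 := fun h =>
    norm_pos_iff.1 (lt_of_le_of_lt (norm_nonneg _) h)
  have r1 := log_unique (X := ℝ) (S := Icc 0 τ) isPreconnected_Icc (g := fun t => φ (1, t))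
    (h := fun t => Complex.log (1 - γi t / γj 1)) ((slice1 1 m1).mono sub1)
    (contOn_log_one_sub hci.continuousOn continuousOn_const hil') (γj 1)
    (fun t ht => by
      rw [hφe (1, t) ⟨m1, sub1 ht⟩, exp_log_one_sub (hil' t ht)]
      have := nz (hil' t ht)
      field_simp) lτ l0
  have r3 := log_unique (X := ℝ) (S := Icc 0 τ) isPreconnected_Icc (g := fun t => φ (t, 1))
    (h := fun t => Complex.log (1 - γj t / γi 1)) ((slice2 1 m1).mono sub1)
    (contOn_log_one_sub hcj.continuousOn continuousOn_const hjl') (-γi 1)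
    (fun t ht => by
      rw [hφe (t, 1) ⟨sub1 ht, m1⟩, exp_log_one_sub (hjl' t ht)]
      have := nz (hjl' t ht)
      field_simp; ring) lτ l0
  have r2 := log_unique (X := ℝ) (S := Icc τ 1) isPreconnected_Icc (g := fun t => φ (0, t))
    (h := fun t => Complex.log (1 - γj 0 / γi t) + Gi t) ((slice1 0 m0).mono sub2)
    ((contOn_log_one_sub continuousOn_const hci.continuousOn hiτ').add hGi) (-1)
    (fun t ht => by
      rw [hφe (0, t) ⟨m0, sub2 ht⟩, Complex.exp_add, exp_log_one_sub (hiτ' t ht), hGie t ht]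
      have := nz (hiτ' t ht)
      field_simp; ring) nτ n1
  have r4 := log_unique (X := ℝ) (S := Icc τ 1) isPreconnected_Icc (g := fun t => φ (t, 0))
    (h := fun t => Complex.log (1 - γi 0 / γj t) + Gj t) ((slice2 0 m0).mono sub2)
    ((contOn_log_one_sub continuousOn_const hcj.continuousOn hjτ').add hGj) 1
    (fun t ht => by
      rw [hφe (t, 0) ⟨sub2 ht, m0⟩, Complex.exp_add, exp_log_one_sub (hjτ' t ht), hGje t ht]
      have := nz (hjτ' t ht)
      field_simp) nτ n1
  obtain ⟨a, ha⟩ : ∃ n : ℤ, φ (1, 0) - Complex.log (1 - γi 0 / γj 1)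
      = Gj 1 + n * (2 * Real.pi * Complex.I) := by
    rw [← Complex.exp_eq_exp_iff_exists_int, Complex.exp_sub, hφe (1, 0) ⟨m1, m0⟩,
      exp_log_one_sub (hil' 0 l0), hGje 1 n1]
    have h1 := nz (hil' 0 l0)
    have h2 : γj 1 - γi 0 ≠ 0 := sub_ne_zero.2 (hne _ m1 _ m0)
    field_simp
  obtain ⟨b, hb⟩ : ∃ n : ℤ, φ (0, 1) - Complex.log (1 - γj 0 / γi 1)
      = (Gi 1 + Real.pi * Complex.I) + n * (2 * Real.pi * Complex.I) := by
    rw [← Complex.exp_eq_exp_iff_exists_int, Complex.exp_sub, hφe (0, 1) ⟨m0, m1⟩,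
      exp_log_one_sub (hjl' 0 l0), Complex.exp_add, hGie 1 n1, Complex.exp_pi_mul_I]
    have h1 := nz (hjl' 0 l0)
    have h2 : γi 1 - γj 0 ≠ 0 := sub_ne_zero.2 (hne _ m0 _ m1).symm
    field_simp
    ring
  refine ⟨a - b - 1, ?_⟩
  push_cast
  linear_combination e1 - e2 + r1 - r2 - r3 + r4 + 2 * ha - 2 * hb

lemma triple_rel {γj γk : ℝ → ℂ} (hcj : Continuous γj) (hck : Continuous γk) {s ρ : ℝ}
    (hρs : ρ < s) {Sj Sk R : Set ℂ} (hSj : IsCompact Sj) (hSk : IsCompact Sk)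
    (hSjc : IsPreconnected Sj) (hSkc : IsPreconnected Sk) (h0j : 0 ∈ Sj) (h0k : 0 ∈ Sk)
    (hj0 : γj 0 ∈ Sj) (hk0 : γk 0 ∈ Sk) (hj1 : ‖γj 1‖ = s) (hk1 : ‖γk 1‖ = s)
    (hSjρ : ∀ z ∈ Sj, ‖z‖ ≤ ρ) (hSkρ : ∀ z ∈ Sk, ‖z‖ ≤ ρ)
    (hR : IsPreconnected R) {w y : ℂ} (hw : w ∈ R) (hy : y ∈ R)
    (hRj : Disjoint R Sj) (hRk : Disjoint R Sk)
    (hRγj : ∀ t ∈ Icc (0:ℝ) 1, γj t ∉ R) (hRγk : ∀ t ∈ Icc (0:ℝ) 1, γk t ∉ R)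
    (hRs : ∀ z ∈ R, ‖z‖ < s) (hwρ : ρ < ‖w‖) (hyρ : ρ < ‖y‖)
    {Aj Ak Pj Pk : ℝ → ℂ} (hAj : ContinuousOn Aj (Icc 0 1)) (hAk : ContinuousOn Ak (Icc 0 1))
    (hPj : ContinuousOn Pj (Icc 0 1)) (hPk : ContinuousOn Pk (Icc 0 1))
    (hAje : ∀ t ∈ Icc (0:ℝ) 1, Complex.exp (Aj t) = γj t - w)
    (hAke : ∀ t ∈ Icc (0:ℝ) 1, Complex.exp (Ak t) = γk t - w)
    (hPje : ∀ t ∈ Icc (0:ℝ) 1, Complex.exp (Pj t) = γj t - y)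
    (hPke : ∀ t ∈ Icc (0:ℝ) 1, Complex.exp (Pk t) = γk t - y) :
    (Aj 1 - Aj 0 - Complex.log (1 - w / γj 1) + Complex.log (1 - γj 0 / w))
      - (Pj 1 - Pj 0 - Complex.log (1 - y / γj 1) + Complex.log (1 - γj 0 / y))
    = (Ak 1 - Ak 0 - Complex.log (1 - w / γk 1) + Complex.log (1 - γk 0 / w))
      - (Pk 1 - Pk 0 - Complex.log (1 - y / γk 1) + Complex.log (1 - γk 0 / y)) := by
  have m0 : (0:ℝ) ∈ Icc (0:ℝ) 1 := by simp
  have m1 : (1:ℝ) ∈ Icc (0:ℝ) 1 := by simp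
  have hs : 0 ≤ s := hj1 ▸ norm_nonneg _
  have nz : ∀ {a b : ℂ}, ‖a‖ < ‖b‖ → b ≠ 0 := fun h =>
    norm_pos_iff.1 (lt_of_le_of_lt (norm_nonneg _) h)
  set K : Set ℂ := (Sj ∪ Sk) ∪ Metric.sphere 0 s ∪ γj '' Icc 0 1 ∪ γk '' Icc 0 1 with hK
  have hKc : IsCompact K := ((((hSj.union hSk).union (isCompact_sphere _ _)).union
    (isCompact_Icc.image hcj)).union (isCompact_Icc.image hck))
  have hRK : Disjoint R K := by
    rw [Set.disjoint_left]
    rintro z hz ((((h | h) | h) | ⟨t, ht, rfl⟩) | ⟨t, ht, rfl⟩)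
    · exact Set.disjoint_left.1 hRj hz h
    · exact Set.disjoint_left.1 hRk hz h
    · exact (hRs z hz).ne (by simpa using h)
    · exact hRγj t ht hz
    · exact hRγk t ht hz
  obtain ⟨L, hL, hLe⟩ := exists_log_ratio hKc hR hRK hw hy
  have s1 : Sj ∪ Sk ⊆ K := fun z hz => Or.inl (Or.inl (Or.inl hz))
  have s2 : Metric.sphere 0 s ⊆ K := fun z hz => Or.inl (Or.inl (Or.inr hz))
  have s3 : ∀ t ∈ Icc (0:ℝ) 1, γj t ∈ K := fun t ht => Or.inl (Or.inr ⟨t, ht, rfl⟩)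
  have s4 : ∀ t ∈ Icc (0:ℝ) 1, γk t ∈ K := fun t ht => Or.inr ⟨t, ht, rfl⟩
  have r1 := log_unique isPreconnected_Icc (S := Icc (0:ℝ) 1) (g := fun t => L (γj t))
    (h := fun t => Aj t - Pj t) (hL.comp hcj.continuousOn s3) (hAj.sub hPj) 1
    (fun t ht => by rw [hLe _ (s3 t ht), Complex.exp_sub, hAje t ht, hPje t ht, one_mul]) m1 m0
  have r2 := log_unique isPreconnected_Icc (S := Icc (0:ℝ) 1) (g := fun t => L (γk t))
    (h := fun t => Ak t - Pk t) (hL.comp hck.continuousOn s4) (hAk.sub hPk) 1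
    (fun t ht => by rw [hLe _ (s4 t ht), Complex.exp_sub, hAke t ht, hPke t ht, one_mul]) m1 m0
  have hSρ : ∀ z ∈ Sj ∪ Sk, ‖z‖ ≤ ρ := by
    rintro z (h | h)
    exacts [hSjρ z h, hSkρ z h]
  have r3 := log_unique (S := Sj ∪ Sk) (hSjc.union 0 h0j h0k hSkc) (g := L)
    (h := fun z => Complex.log (1 - z / w) - Complex.log (1 - z / y)) (hL.mono s1)
    ((contOn_log_one_sub continuousOn_id continuousOn_const
      fun z hz => (hSρ z hz).trans_lt hwρ).sub
      (contOn_log_one_sub continuousOn_id continuousOn_const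
      fun z hz => (hSρ z hz).trans_lt hyρ)) (w / y)
    (fun z hz => by
      have hzw := (hSρ z hz).trans_lt hwρ
      have hzy := (hSρ z hz).trans_lt hyρ
      rw [hLe z (s1 hz), Complex.exp_sub, exp_log_one_sub hzw, exp_log_one_sub hzy]
      have h1 := nz hzw
      have h2 := nz hzy
      have h3 : y - z ≠ 0 := sub_ne_zero.2 (fun h => hzy.ne (by rw [h]))
      have h4 : z - y ≠ 0 := sub_ne_zero.2 (fun h => hzy.ne (by rw [h]))
      field_simp
      ring) (Or.inl hj0) (Or.inr hk0)
  have hsph : ∀ z ∈ Metric.sphere (0:ℂ) s, ‖z‖ = s := by simp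
  have r4 := log_unique (S := Metric.sphere (0:ℂ) s)
    (isPreconnected_sphere (by rw [Complex.rank_real_complex]; norm_num) _ _) (g := L)
    (h := fun z => Complex.log (1 - w / z) - Complex.log (1 - y / z)) (hL.mono s2)
    ((contOn_log_one_sub continuousOn_const continuousOn_id
      fun z hz => by show _ < ‖z‖; rw [hsph z hz]; exact hRs w hw).sub
      (contOn_log_one_sub continuousOn_const continuousOn_id
      fun z hz => by show _ < ‖z‖; rw [hsph z hz]; exact hRs y hy)) 1
    (fun z hz => by
      have hzw : ‖w‖ < ‖z‖ := by rw [hsph z hz]; exact hRs w hw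
      have hzy : ‖y‖ < ‖z‖ := by rw [hsph z hz]; exact hRs y hy
      rw [hLe z (s2 hz), Complex.exp_sub, exp_log_one_sub hzw, exp_log_one_sub hzy]
      have h1 := nz hzw
      have h4 : z - y ≠ 0 := sub_ne_zero.2 (fun h => hzy.ne (by rw [h]))
      field_simp) (x := γj 1) (y := γk 1) (by simpa using hj1) (by simpa using hk1)
  linear_combination -r1 + r2 - r3 + r4

lemma no_k33 {γ : Fin 3 → ℝ → ℂ} (hc : ∀ i, Continuous (γ i)) {s ρ : ℝ} (hρ : 0 ≤ ρ)
    (hρs : ρ < s) {S R : Fin 3 → Set ℂ} (hS : ∀ i, IsCompact (S i))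
    (hSc : ∀ i, IsPreconnected (S i)) (h0 : ∀ i, 0 ∈ S i) (hγ0 : ∀ i, γ i 0 ∈ S i)
    (hγ1 : ∀ i, ‖γ i 1‖ = s) (hSρ : ∀ i, ∀ z ∈ S i, ‖z‖ ≤ ρ)
    (hR : ∀ i, IsPreconnected (R i)) {w : ℂ} (hw : ∀ i, w ∈ R i) (hwρ : ρ < ‖w‖)
    (hRs : ∀ i, ∀ z ∈ R i, ‖z‖ < s) (hγR : ∀ i, ∀ t ∈ Ico (0:ℝ) 1, γ i t ∈ R i)
    (hRS : ∀ i j, i ≠ j → Disjoint (R i) (S j))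
    (hRγ : ∀ i j, i ≠ j → ∀ t ∈ Icc (0:ℝ) 1, γ j t ∉ R i)
    (hne : γ 0 1 ≠ γ 1 1 ∧ γ 1 1 ≠ γ 2 1 ∧ γ 2 1 ≠ γ 0 1) : False := by
  obtain ⟨hn1, hn2, hn3⟩ := hne
  have hne' : ∀ i j, i ≠ j → γ i 1 ≠ γ j 1 := by
    intro i j hij
    fin_cases i <;> fin_cases j <;> first | exact absurd rfl hij | assumption | (symm; assumption)
  have hlt : ∀ i, ∀ t ∈ Ico (0:ℝ) 1, ‖γ i t‖ < s := fun i t ht => hRs i _ (hγR i t ht)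
  have hγne : ∀ i j, i ≠ j → ∀ a ∈ Icc (0:ℝ) 1, ∀ b ∈ Icc (0:ℝ) 1, γ j a ≠ γ i b := by
    intro i j hij a ha b hb
    rcases eq_or_lt_of_le hb.2 with rfl | hb1
    · rcases eq_or_lt_of_le ha.2 with rfl | ha1
      · exact hne' j i hij.symm
      · intro h
        have := hlt j a ⟨ha.1, ha1⟩
        rw [h, hγ1] at this
        exact lt_irrefl _ this
    · intro h
      exact hRγ i j hij a ha (h ▸ hγR i b ⟨hb.1, hb1⟩)
  obtain ⟨τ, hτ0, hτ1, hτ⟩ : ∃ τ : ℝ, 0 ≤ τ ∧ τ < 1 ∧ ∀ i, ∀ t ∈ Icc τ 1, ρ < ‖γ i t‖ := by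
    have : ∀ᶠ t in 𝓝 (1:ℝ), ∀ i, ρ < ‖γ i t‖ := by
      rw [Filter.eventually_all]
      intro i
      apply continuousAt_const.eventually_lt (hc i).norm.continuousAt
      rw [hγ1]; exact hρs
    obtain ⟨δ, hδ, h⟩ := Metric.eventually_nhds_iff.1 this
    refine ⟨max 0 (1 - δ / 2), le_max_left _ _, by simp [hδ], ?_⟩
    intro i t ht
    apply h
    rw [Real.dist_eq, abs_lt]
    have := (le_max_right 0 (1 - δ / 2)).trans ht.1
    constructor <;> linarith [ht.2]
  have mτ : τ ∈ Icc (0:ℝ) 1 := ⟨hτ0, hτ1.le⟩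
  have nτ : τ ∈ Icc τ 1 := ⟨le_rfl, hτ1.le⟩
  have exG : ∀ i, ∃ G : ℝ → ℂ, ContinuousOn G (Icc τ 1) ∧
      ∀ t ∈ Icc τ 1, Complex.exp (G t) = γ i t := fun i =>
    exists_log_convex (convex_Icc _ _) isCompact_Icc ⟨τ, nτ⟩ (hc i).continuousOn
      fun t ht => norm_pos_iff.1 (hρ.trans_lt (hτ i t ht))
  have ex1 : ∀ i, ∀ y : ℂ, (∀ t ∈ Icc (0:ℝ) 1, γ i t ≠ y) →
      ∃ G : ℝ → ℂ, ContinuousOn G (Icc 0 1) ∧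
      ∀ t ∈ Icc (0:ℝ) 1, Complex.exp (G t) = γ i t - y := fun i y h =>
    exists_log_convex (convex_Icc _ _) isCompact_Icc ⟨τ, mτ⟩
      ((hc i).sub continuous_const).continuousOn fun t ht => sub_ne_zero.2 (h t ht)
  have exA : ∀ i, ∃ G : ℝ → ℂ, ContinuousOn G (Icc 0 1) ∧
      ∀ t ∈ Icc (0:ℝ) 1, Complex.exp (G t) = γ i t - w := fun i => ex1 i w fun t ht h =>
    hRγ (i + 1) i (by fin_cases i <;> decide) t ht (h ▸ hw _)
  have exP : ∀ i j, ∃ G : ℝ → ℂ, i ≠ j → (ContinuousOn G (Icc 0 1) ∧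
      ∀ t ∈ Icc (0:ℝ) 1, Complex.exp (G t) = γ j t - γ i τ) := fun i j => by
    by_cases h : i = j
    · exact ⟨0, fun h' => absurd h h'⟩
    · obtain ⟨G, hG⟩ := ex1 j (γ i τ) fun t ht => hγne i j h t ht τ mτ
      exact ⟨G, fun _ => hG⟩
  choose G hG hGe using exG
  choose A hA hAe using exA
  choose P hP using exP
  have T : ∀ i j k, i ≠ j → i ≠ k → _ := fun i j k hij hik =>
    triple_rel (hc j) (hc k) hρs (hS j) (hS k) (hSc j) (hSc k) (h0 j) (h0 k) (hγ0 j) (hγ0 k)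
      (hγ1 j) (hγ1 k) (hSρ j) (hSρ k) (hR i) (hw i) (hγR i τ ⟨hτ0, hτ1⟩) (hRS i j hij)
      (hRS i k hik) (hRγ i j hij) (hRγ i k hik) (hRs i) hwρ (hτ i τ nτ) (hA j) (hA k)
      (hP i j hij).1 (hP i k hik).1 (hAe j) (hAe k) (hP i j hij).2 (hP i k hik).2
  have O : ∀ i j, i ≠ j → _ := fun i j hij =>
    pair_odd (hc i) (hc j) hρs hτ0 hτ1 (hγ1 i) (hlt i) (hSρ i _ (hγ0 i)) (hτ i)
      (hγ1 j) (hlt j) (hSρ j _ (hγ0 j)) (hτ j) (hγne i j hij) (hG i) (hG j) (hGe i) (hGe j)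
      (hP i j hij).1 (hP j i hij.symm).1 (hP i j hij).2 (hP j i hij.symm).2
  have t0 := T 0 1 2 (by decide) (by decide)
  have t1 := T 1 2 0 (by decide) (by decide)
  have t2 := T 2 0 1 (by decide) (by decide)
  obtain ⟨a, ha⟩ := O 0 1 (by decide)
  obtain ⟨b, hb⟩ := O 1 2 (by decide)
  obtain ⟨c, hc'⟩ := O 2 0 (by decide)
  have hsum : ((2 * (a + b + c) + 3 : ℤ) : ℂ) * (2 * Real.pi * Complex.I) = 0 := by
    push_cast
    linear_combination -ha - hb - hc' - t0 - t1 - t2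
  have h2 : (2 * Real.pi * Complex.I : ℂ) ≠ 0 := Complex.two_pi_I_ne_zero
  have h3 := (mul_eq_zero.1 hsum).resolve_right h2
  have h4 : (2 * (a + b + c) + 3 : ℤ) = 0 := by exact_mod_cast h3
  omega

lemma exists_exit_path {A : Set ℂ} (hA : IsClosed A) {s : ℝ}
    (hnh : ∀ u, u ∉ A → ‖u‖ < s → ∃ o ∈ connectedComponentIn Aᶜ u, s < ‖o‖)
    {u : ℂ} (hu : u ∉ A) (hus : ‖u‖ < s) :
    ∃ γ : ℝ → ℂ, Continuous γ ∧ γ 0 = u ∧ ‖γ 1‖ = s ∧ γ 1 ∉ A ∧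
      ∀ t ∈ Ico (0:ℝ) 1, γ t ∈ connectedComponentIn (Aᶜ ∩ Metric.ball 0 s) u := by
  obtain ⟨o, ho, hos⟩ := hnh u hu hus
  have hO : IsOpen (connectedComponentIn Aᶜ u) := hA.isOpen_compl.connectedComponentIn
  have hOc : IsConnected (connectedComponentIn Aᶜ u) :=
    isConnected_connectedComponentIn_iff.2 hu
  have hp := (hO.isConnected_iff_isPathConnected.1 hOc).joinedIn u (mem_connectedComponentIn hu)
    o ho
  obtain ⟨p, hp⟩ := hp
  set σ : ℝ → ℂ := fun t => p.extend t with hσ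
  have hσc : Continuous σ := map_continuous p.extend
  have hσA : ∀ t, σ t ∉ A := by
    intro t
    have : σ t ∈ range p := by
      rw [← p.extend_range]; exact mem_range_self t
    obtain ⟨t', ht'⟩ := this
    rw [← ht']
    exact connectedComponentIn_subset _ _ (hp t')
  have hσ0 : σ 0 = u := by simp [hσ]
  have hσ1 : σ 1 = o := by simp [hσ]
  have hTc : IsCompact (Icc (0:ℝ) 1 ∩ {t | s ≤ ‖σ t‖}) :=
    isCompact_Icc.inter_right (isClosed_le continuous_const hσc.norm)
  obtain ⟨τ, ⟨hτI, hτs⟩, hτl⟩ := hTc.exists_isLeast ⟨1, by simp, by simp [hσ1, hos.le]⟩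
  have hτs' : s ≤ ‖σ τ‖ := hτs
  obtain ⟨t, ht, hts⟩ := intermediate_value_Icc hτI.1 (hσc.norm.continuousOn)
    (show s ∈ Icc ‖σ 0‖ ‖σ τ‖ from ⟨by rw [hσ0]; exact hus.le, hτs'⟩)
  have htτ : t = τ := le_antisymm ht.2
    (hτl ⟨⟨ht.1, ht.2.trans hτI.2⟩, show s ≤ ‖σ t‖ from hts.ge⟩)
  subst htτ
  have ht0 : 0 < t := by
    rcases eq_or_lt_of_le ht.1 with h | h
    · rw [← h, hσ0] at hτs'
      exact absurd hus (not_lt.2 hτs')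
    · exact h
  refine ⟨fun x => σ (t * x), by fun_prop, by simp [hσ0], by simpa using hts, hσA _, ?_⟩
  intro x hx
  have hmem : ∀ y ∈ Icc 0 (t * x), σ y ∈ Aᶜ ∩ Metric.ball 0 s := by
    intro y hy
    refine ⟨hσA y, ?_⟩
    rw [mem_ball_zero_iff]
    by_contra hcon
    have hyt : y < t := lt_of_le_of_lt hy.2 (by nlinarith [hx.2])
    exact absurd (hτl ⟨⟨hy.1, hyt.le.trans hτI.2⟩, not_lt.1 hcon⟩) (not_le.2 hyt)
  have h0x : 0 ≤ t * x := mul_nonneg ht0.le hx.1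
  have hpre : IsPreconnected (σ '' Icc 0 (t * x)) :=
    isPreconnected_Icc.image _ hσc.continuousOn
  have := hpre.subset_connectedComponentIn (x := u) (F := Aᶜ ∩ Metric.ball 0 s)
    ⟨0, ⟨le_rfl, h0x⟩, hσ0⟩ (by rintro _ ⟨y, hy, rfl⟩; exact hmem y hy)
  exact this ⟨t * x, ⟨h0x, le_rfl⟩, rfl⟩

lemma exists_hook {A : Set ℂ} (hA : IsClosed A) {s : ℝ} {x : ℂ} (hx : x ∈ A)
    (hlc : ∀ ε > 0, ∃ δ > 0, ∀ y ∈ A, dist y x < δ → ∃ C ⊆ A, C ⊆ Metric.ball x ε ∧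
      IsPreconnected C ∧ x ∈ C ∧ y ∈ C) {ε : ℝ} (hε : 0 < ε)
    (hb : Metric.closedBall x ε ⊆ Metric.ball 0 s) :
    ∃ δ > 0, ∀ v ∉ A, dist v x < δ → ∃ S, IsCompact S ∧ IsPreconnected S ∧ x ∈ S ∧ v ∈ S ∧
      S ⊆ Metric.closedBall x ε ∧ S ⊆ A ∪ connectedComponentIn (Aᶜ ∩ Metric.ball 0 s) v := by
  obtain ⟨δ, hδ, h⟩ := hlc ε hε
  refine ⟨min (δ / 2) (ε / 2), by positivity, ?_⟩
  intro v hv hvx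
  have hv1 := hvx.trans_le (min_le_left _ _)
  have hv2 := hvx.trans_le (min_le_right _ _)
  obtain ⟨a, ha, had⟩ := hA.exists_infDist_eq_dist ⟨x, hx⟩ v
  have hax : dist v a ≤ dist v x := had ▸ Metric.infDist_le_dist_of_mem hx
  have hax' : dist a x ≤ dist v a + dist v x := dist_triangle_left a x v
  obtain ⟨C, hCA, hCb, hC, hxC, haC⟩ := h a ha (by linarith)
  have hva : a ≠ v := fun e => hv (e ▸ ha)
  have hvb : v ∈ Metric.closedBall x ε := by rw [Metric.mem_closedBall]; linarith
  have hab : a ∈ Metric.closedBall x ε := by rw [Metric.mem_closedBall]; linarith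
  have hseg : segment ℝ v a ⊆ Metric.closedBall x ε :=
    (convex_closedBall x ε).segment_subset hvb hab
  have hlin : Continuous (AffineMap.lineMap v a : ℝ → ℂ) := AffineMap.lineMap_continuous
  have hclC : closure C ⊆ A := closure_minimal hCA hA
  have hclC2 : closure C ⊆ Metric.closedBall x ε :=
    closure_minimal (hCb.trans Metric.ball_subset_closedBall) Metric.isClosed_closedBall
  refine ⟨closure C ∪ segment ℝ v a, ?_, ?_, Or.inl (subset_closure hxC),
    Or.inr (left_mem_segment _ _ _), union_subset hclC2 hseg, ?_⟩
  · apply IsCompact.union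
    · exact (isCompact_closedBall x ε).of_isClosed_subset isClosed_closure hclC2
    · rw [segment_eq_image_lineMap]
      exact isCompact_Icc.image hlin
  · exact hC.closure.union a (subset_closure haC) (right_mem_segment _ _ _)
      (convex_segment v a).isPreconnected
  · apply union_subset (hclC.trans subset_union_left)
    rw [segment_eq_image_lineMap]
    rintro _ ⟨t, ht, rfl⟩
    rcases eq_or_lt_of_le ht.2 with rfl | ht1
    · left; simpa using ha
    · right
      have hpre : IsPreconnected ((AffineMap.lineMap v a : ℝ → ℂ) '' Icc 0 t) :=
        isPreconnected_Icc.image _ hlin.continuousOn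
      refine hpre.subset_connectedComponentIn ⟨0, ⟨le_rfl, ht.1⟩, by simp⟩ ?_
        ⟨t, ⟨ht.1, le_rfl⟩, rfl⟩
      rintro _ ⟨y, hy, rfl⟩
      refine ⟨?_, hb (hseg ?_)⟩
      · intro hyA
        have h1 := Metric.infDist_le_dist_of_mem (x := v) hyA
        rw [had, dist_left_lineMap, Real.norm_of_nonneg hy.1] at h1
        have h2 : 0 < dist v a := dist_pos.2 hva.symm
        nlinarith [hy.2]
      · rw [segment_eq_image_lineMap]
        exact ⟨y, ⟨hy.1, hy.2.trans ht.2⟩, rfl⟩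

lemma no_seq {A : Set ℂ} (hA : IsClosed A) {s : ℝ} (hs : 0 < s) (h0A : (0:ℂ) ∈ A)
    (hnh : ∀ u, u ∉ A → ‖u‖ < s → ∃ o ∈ connectedComponentIn Aᶜ u, s < ‖o‖)
    (hlc : ∀ x ∈ A, ‖x‖ < s → ∀ ε > 0, ∃ δ > 0, ∀ y ∈ A, dist y x < δ →
      ∃ C ⊆ A, C ⊆ Metric.ball x ε ∧ IsPreconnected C ∧ x ∈ C ∧ y ∈ C)
    (v : ℕ → ℂ) (hv : ∀ n, v n ∉ A) (hvs : ∀ n, ‖v n‖ < s / 2)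
    (hv0 : Filter.Tendsto v Filter.atTop (𝓝 0))
    (hcl : ∀ n, (0:ℂ) ∉ closure (connectedComponentIn (Aᶜ ∩ Metric.ball 0 s) (v n))) :
    False := by
  set W : Set ℂ := Aᶜ ∩ Metric.ball 0 s with hW
  set V : ℕ → Set ℂ := fun n => connectedComponentIn W (v n) with hV
  have hVW : ∀ n, V n ⊆ W := fun n => connectedComponentIn_subset _ _
  have hex := fun n => exists_exit_path hA hnh (hv n) (show ‖v n‖ < s by linarith [hvs n])
  choose γ hγc hγ0 hγ1 hγA hγV using hex
  have hy : ∀ n, ∃ y ∈ V n, ‖y‖ = s / 2 := by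
    intro n
    obtain ⟨t, ht, hts⟩ := intermediate_value_Icc zero_le_one ((hγc n).norm.continuousOn)
      (show s / 2 ∈ Icc ‖γ n 0‖ ‖γ n 1‖ from ⟨by rw [hγ0]; exact (hvs n).le, by
        rw [hγ1]; linarith⟩)
    have ht1 : t ≠ 1 := by
      rintro rfl
      have := hγ1 n
      simp only at hts
      linarith
    exact ⟨γ n t, hγV n t ⟨ht.1, lt_of_le_of_ne ht.2 ht1⟩, hts⟩
  choose y hyV hys using hy
  obtain ⟨q, hq, φ, hφ, hφq⟩ := (isCompact_sphere (0:ℂ) (s / 2)).tendsto_subseq (x := y)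
    (fun n => by simpa using hys n)
  have hq' : ‖q‖ = s / 2 := by simpa using hq
  have hsep : ∀ n, ∀ᶠ m in Filter.atTop, v (φ m) ∉ V n := by
    intro n
    have : ∀ᶠ z in 𝓝 (0:ℂ), z ∉ V n := by
      have := isClosed_closure.isOpen_compl.mem_nhds (hcl n)
      filter_upwards [this] with z hz hz'
      exact hz (subset_closure hz')
    exact (hv0.comp hφ.tendsto_atTop).eventually this
  have hVeq : ∀ n, ∀ z ∈ V n, connectedComponentIn W z = V n := fun n z hz =>
    (connectedComponentIn_eq hz).symm
  have hvV : ∀ n, v n ∈ V n := fun n => mem_connectedComponentIn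
    ⟨hv n, by rw [mem_ball_zero_iff]; linarith [hvs n]⟩
  have hdisj : ∀ n m, v m ∉ V n → Disjoint (V n) (V m) := by
    intro n m h
    rw [Set.disjoint_left]
    intro z hz hz'
    apply h
    rw [← hVeq n z hz, hVeq m z hz']
    exact hvV m
  have hqA : q ∈ A := by
    by_contra hqA
    have hWo : IsOpen W := hA.isOpen_compl.inter Metric.isOpen_ball
    have hqW : q ∈ W := ⟨hqA, by rw [mem_ball_zero_iff]; linarith⟩
    have hqo : IsOpen (connectedComponentIn W q) := hWo.connectedComponentIn
    have hev := hφq.eventually (hqo.mem_nhds (mem_connectedComponentIn hqW))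
    obtain ⟨n, hn⟩ := hev.exists
    obtain ⟨m, hm, hm'⟩ := (hev.and (hsep (φ n))).exists
    apply Set.disjoint_left.1 (hdisj _ _ hm') (hyV (φ n))
    rw [← hVeq _ _ (hyV (φ m))]
    simp only [Function.comp] at hn hm
    rw [← connectedComponentIn_eq hm]
    exact hn
  obtain ⟨δ1, hδ1, hook1⟩ := exists_hook hA (s := s) h0A (hlc 0 h0A (by simpa using hs))
    (ε := s / 8) (by positivity) (by
      intro z hz
      rw [mem_ball_zero_iff]; rw [mem_closedBall_zero_iff] at hz; linarith)
  obtain ⟨δ2, hδ2, hook2⟩ := exists_hook hA (s := s) hqA (hlc q hqA (by linarith))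
    (ε := s / 8) (by positivity) (by
      intro z hz
      rw [mem_ball_zero_iff]; rw [mem_closedBall_iff_norm] at hz
      have := norm_le_norm_add_norm_sub' z q
      linarith)
  have hev1 : ∀ᶠ n in Filter.atTop, dist (v (φ n)) 0 < δ1 :=
    (hv0.comp hφ.tendsto_atTop).eventually (Metric.ball_mem_nhds _ hδ1)
  have hev2 : ∀ᶠ n in Filter.atTop, dist (y (φ n)) q < δ2 :=
    hφq.eventually (Metric.ball_mem_nhds _ hδ2)
  have hev := hev1.and hev2
  obtain ⟨n0, h01, h02⟩ := hev.exists
  obtain ⟨n1, ⟨h11, h12⟩, h13⟩ := (hev.and (hsep (φ n0))).exists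
  obtain ⟨n2, ⟨⟨h21, h22⟩, h23⟩, h24⟩ := ((hev.and (hsep (φ n0))).and (hsep (φ n1))).exists
  obtain ⟨m, hm1, hm2, hmd⟩ : ∃ m : Fin 3 → ℕ, (∀ i, dist (v (m i)) 0 < δ1) ∧
      (∀ i, dist (y (m i)) q < δ2) ∧ ∀ i j, i ≠ j → Disjoint (V (m i)) (V (m j)) := by
    have d01 := hdisj _ _ h13
    have d02 := hdisj _ _ h23
    have d12 := hdisj _ _ h24
    refine ⟨![φ n0, φ n1, φ n2], ?_, ?_, ?_⟩
    · intro i; fin_cases i <;> assumption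
    · intro i; fin_cases i <;> assumption
    · intro i j hij
      fin_cases i <;> fin_cases j <;>
        first | exact absurd rfl hij | assumption | (symm; assumption)
  have hS := fun i => hook1 (v (m i)) (hv _) (hm1 i)
  choose S hSc hSp hS0 hSv hSb hSA using hS
  have hQ := fun i => hook2 (y (m i)) (hVW _ (hyV _)).1 (hm2 i)
  choose Q hQc hQp hQ0 hQy hQb hQA using hQ
  have hQA' : ∀ i, Q i ⊆ A ∪ V (m i) := by
    intro i
    have := hQA i
    rwa [← hW, hVeq _ _ (hyV (m i))] at this
  have hSA' : ∀ i, S i ⊆ A ∪ V (m i) := hSA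
  have hQn : ∀ i, ∀ z ∈ Q i, s / 4 < ‖z‖ ∧ ‖z‖ < s := by
    intro i z hz
    have h1 := hQb i hz
    rw [mem_closedBall_iff_norm] at h1
    have h2 := norm_le_norm_add_norm_sub' z q
    have h3 := norm_le_norm_add_norm_sub' q z
    rw [norm_sub_rev] at h3
    constructor <;> linarith
  have hSn : ∀ i, ∀ z ∈ S i, ‖z‖ ≤ s / 8 := by
    intro i z hz
    simpa using hSb i hz
  have hVn : ∀ i, ∀ z ∈ V (m i), ‖z‖ < s := fun i z hz => by
    simpa using (hVW _ hz).2
  have hVA : ∀ i, ∀ z ∈ V (m i), z ∉ A := fun i z hz => (hVW _ hz).1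
  have hRn : ∀ i, ∀ z ∈ Q i ∪ V (m i), ‖z‖ < s := by
    rintro i z (h | h)
    exacts [(hQn i z h).2, hVn i z h]
  have hend : ∀ i j, i ≠ j → γ (m i) 1 ≠ γ (m j) 1 := by
    intro i j hij he
    obtain ⟨η, hη, hb⟩ := Metric.isOpen_iff.1 hA.isOpen_compl _ (hγA (m i))
    have hconv : IsPreconnected (Metric.ball (γ (m i) 1) η ∩ Metric.ball 0 s) :=
      ((convex_ball _ _).inter (convex_ball _ _)).isPreconnected
    have hpt : ∀ k, γ (m k) 1 = γ (m i) 1 → ∃ z ∈ V (m k), z ∈ Metric.ball (γ (m i) 1) η := by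
      intro k hk
      have h1 : ∀ᶠ t in 𝓝[<] (1:ℝ), γ (m k) t ∈ Metric.ball (γ (m i) 1) η := by
        apply (hγc (m k)).continuousAt.continuousWithinAt
        rw [hk]
        exact Metric.ball_mem_nhds _ hη
      have h2 : ∀ᶠ t in 𝓝[<] (1:ℝ), t ∈ Ico (0:ℝ) 1 :=
        Ico_mem_nhdsLT zero_lt_one
      obtain ⟨t, ht1, ht2⟩ := (h1.and h2).exists
      exact ⟨_, hγV _ t ht2, ht1⟩
    obtain ⟨z, hz, hzb⟩ := hpt i rfl
    obtain ⟨z', hz', hzb'⟩ := hpt j he.symm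
    have := hconv.subset_connectedComponentIn (F := W) ⟨hzb, (hVW _ hz).2⟩
      (inter_subset_inter_left _ hb) ⟨hzb', (hVW _ hz').2⟩
    rw [hVeq _ _ hz] at this
    exact Set.disjoint_left.1 (hmd i j hij) this hz'
  refine no_k33 (γ := fun i => γ (m i)) (s := s) (ρ := s / 8) (S := S)
    (R := fun i => Q i ∪ V (m i)) (w := q) (fun i => hγc _) (by positivity) (by linarith) hSc hSp
    hS0 (fun i => by rw [hγ0]; exact hSv i) (fun i => hγ1 _) hSn ?_ (fun i => Or.inl (hQ0 i))
    (by linarith) hRn (fun i t ht => Or.inr (hγV _ t ht)) ?_ ?_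
    ⟨hend _ _ (by decide), hend _ _ (by decide), hend _ _ (by decide)⟩
  · intro i
    exact (hQp i).union (y (m i)) (hQy i) (hyV _) isPreconnected_connectedComponentIn
  · intro i j hij
    rw [Set.disjoint_left]
    rintro z (h | h) hz
    · have := (hQn i z h).1
      have := hSn j z hz
      linarith
    · rcases hSA' j hz with h' | h'
      · exact hVA i z h h'
      · exact Set.disjoint_left.1 (hmd i j hij) h h'
  · intro i j hij t ht hR
    rcases eq_or_lt_of_le ht.2 with rfl | ht1
    · exact (hRn i _ hR).ne (hγ1 _)
    · have hj := hγV (m j) t ⟨ht.1, ht1⟩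
      rcases hR with h | h
      · rcases hQA' i h with h' | h'
        · exact hVA j _ hj h'
        · exact Set.disjoint_left.1 (hmd i j hij) h' hj
      · exact Set.disjoint_left.1 (hmd i j hij) h hj

lemma exists_split {M : Set ℂ} (hM : IsCompact M) {a x : ℂ} (ha : a ∈ M) (hx : x ∈ M)
    (hn : x ∉ connectedComponentIn M a) :
    ∃ M1 M2 : Set ℂ, IsClosed M1 ∧ IsClosed M2 ∧ Disjoint M1 M2 ∧ M ⊆ M1 ∪ M2 ∧ a ∈ M1 ∧
      x ∈ M2 := by
  have := isCompact_iff_compactSpace.1 hM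
  have hn' : (⟨x, hx⟩ : M) ∉ connectedComponent (⟨a, ha⟩ : M) := by
    intro h
    apply hn
    rw [connectedComponentIn_eq_image ha]
    exact ⟨_, h, rfl⟩
  rw [connectedComponent_eq_iInter_isClopen] at hn'
  simp only [mem_iInter, not_forall] at hn'
  obtain ⟨⟨Z, hZ, haZ⟩, hxZ⟩ := hn'
  refine ⟨Subtype.val '' Z, Subtype.val '' Zᶜ, ?_, ?_, ?_, ?_, ⟨_, haZ, rfl⟩, ⟨_, hxZ, rfl⟩⟩
  · exact (hZ.1.isCompact.image continuous_subtype_val).isClosed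
  · exact (hZ.compl.1.isCompact.image continuous_subtype_val).isClosed
  · exact (disjoint_image_iff Subtype.val_injective).2 disjoint_compl_right
  · intro z hz
    by_cases h : (⟨z, hz⟩ : M) ∈ Z
    · exact Or.inl ⟨_, h, rfl⟩
    · exact Or.inr ⟨_, h, rfl⟩

lemma step_one {A : Set ℂ} (hA : IsClosed A) {s : ℝ} (hs : 0 < s) (h0 : (0:ℂ) ∈ frontier A)
    {x : ℂ} (hx : x ∈ frontier A) (hxs : ‖x‖ < s)
    (hn : x ∉ connectedComponentIn (frontier A ∩ Metric.closedBall 0 s) 0)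
    {C : Set ℂ} (hCA : C ⊆ A) (hCb : C ⊆ Metric.ball 0 s) (hC : IsPreconnected C)
    (h0C : (0:ℂ) ∈ C) (hxC : x ∈ C) {η : ℝ} (hη : 0 < η) :
    ∃ v, v ∉ A ∧ dist v x < η ∧
      (0:ℂ) ∉ closure (connectedComponentIn (Aᶜ ∩ Metric.ball 0 s) v) := by
  classical
  have hMc : IsCompact (frontier A ∩ Metric.closedBall 0 s) :=
    (isCompact_closedBall _ _).inter_left isClosed_frontier
  obtain ⟨M1, M2, hM1, hM2, hd, hsub, h01, hx2⟩ := exists_split hMc (a := 0) (x := x)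
    ⟨h0, by simp [hs.le]⟩ ⟨hx, by simpa using hxs.le⟩ hn
  obtain ⟨u, hu1, hu2, -⟩ := exists_continuous_zero_one_of_isClosed hM1 hM2 hd
  set g : ℂ → ℂ := fun z => if z ∈ A then Complex.exp (u z * (2 * Real.pi * Complex.I)) else 1
    with hg
  have hgc : ContinuousOn g (Metric.closedBall 0 s) := by
    apply ContinuousOn.if
    · rintro a ⟨ha1, ha2⟩
      rcases hsub ⟨ha2, ha1⟩ with h | h
      · rw [hu1 h]; simp
      · rw [hu2 h]; simp [Complex.exp_two_pi_mul_I]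
    · apply Continuous.continuousOn
      have := u.continuous
      fun_prop
    · exact continuousOn_const
  have hg0 : ∀ z ∈ Metric.closedBall (0:ℂ) s, g z ≠ 0 := by
    intro z _
    simp only [hg]
    split_ifs
    · exact Complex.exp_ne_zero _
    · exact one_ne_zero
  obtain ⟨θ, hθ, hθe⟩ := exists_log_convex (convex_closedBall (0:ℂ) s) (isCompact_closedBall _ _)
    ⟨0, by simp [hs.le]⟩ hgc hg0
  have hCb' := hCb.trans Metric.ball_subset_closedBall
  have e1 := log_unique hC (g := θ) (h := fun z => (u z : ℂ) * (2 * Real.pi * Complex.I))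
    (hθ.mono hCb') (by
      apply Continuous.continuousOn
      have := u.continuous
      fun_prop) 1 (fun z hz => by
        rw [hθe z (hCb' hz), one_mul]
        simp only [hg, hCA hz, if_true]) hxC h0C
  have e2 : θ x - θ 0 = 2 * Real.pi * Complex.I := by
    rw [hu1 h01, hu2 hx2] at e1
    simp at e1
    linear_combination e1
  have near : ∀ z, ‖z‖ < s → ∃ η' > 0, ∀ y, dist y z < η' → ‖y‖ < s ∧ dist (θ y) (θ z) < 1 := by
    intro z hz
    have hmem : Metric.closedBall (0:ℂ) s ∈ 𝓝 z :=
      Filter.mem_of_superset (Metric.isOpen_ball.mem_nhds (by simpa using hz))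
        Metric.ball_subset_closedBall
    have h1 : ∀ᶠ y in 𝓝 z, dist (θ y) (θ z) < 1 :=
      (hθ.continuousAt hmem).eventually (Metric.ball_mem_nhds _ one_pos)
    have h2 : ∀ᶠ y in 𝓝 z, ‖y‖ < s := continuous_norm.continuousAt.eventually_lt
      continuousAt_const hz
    exact Metric.eventually_nhds_iff.1 (h2.and h1)
  obtain ⟨ηx, hηx, hnx⟩ := near x hxs
  obtain ⟨η0, hη0, hn0⟩ := near 0 (by simpa using hs)
  have hxcl : x ∈ closure Aᶜ := by
    rw [frontier_eq_closure_inter_closure] at hx; exact hx.2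
  obtain ⟨v, hvA, hvx⟩ := Metric.mem_closure_iff.1 hxcl (min η ηx) (lt_min hη hηx)
  rw [dist_comm] at hvx
  obtain ⟨hvs, hvθ⟩ := hnx v (hvx.trans_le (min_le_right _ _))
  refine ⟨v, hvA, hvx.trans_le (min_le_left _ _), ?_⟩
  intro hcl
  obtain ⟨v', hv', hv'd⟩ := Metric.mem_closure_iff.1 hcl η0 hη0
  rw [dist_comm] at hv'd
  obtain ⟨-, hv'θ⟩ := hn0 v' hv'd
  have hVW := connectedComponentIn_subset (Aᶜ ∩ Metric.ball 0 s) v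
  have hVb : connectedComponentIn (Aᶜ ∩ Metric.ball 0 s) v ⊆ Metric.closedBall 0 s :=
    fun z hz => Metric.ball_subset_closedBall (hVW hz).2
  have e3 := log_unique (S := connectedComponentIn (Aᶜ ∩ Metric.ball 0 s) v)
    isPreconnected_connectedComponentIn (g := θ) (h := fun _ => 0) (hθ.mono hVb)
    continuousOn_const 1 (fun z hz => by
      rw [hθe z (hVb hz)]
      have : z ∉ A := (hVW hz).1
      simp [hg, this]) (mem_connectedComponentIn ⟨hvA, by simpa using hvs⟩) hv'
  simp only [sub_zero] at e3
  have h5 : ‖θ x - θ 0‖ < 2 := by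
    rw [← dist_eq_norm]
    have := dist_triangle (θ x) (θ v) (θ 0)
    rw [dist_comm (θ x) (θ v)] at this
    rw [e3] at hvθ this
    linarith
  rw [e2] at h5
  have hpi := Real.pi_gt_three
  simp [abs_of_pos Real.pi_pos] at h5
  linarith

theorem planar {A : Set ℂ} (hA : IsClosed A) {s : ℝ} (hs : 0 < s) (h0 : (0:ℂ) ∈ frontier A)
    (hnh : ∀ u, u ∉ A → ‖u‖ < s → ∃ o ∈ connectedComponentIn Aᶜ u, s < ‖o‖)
    (hlc : ∀ x ∈ A, ‖x‖ < s → ∀ ε > 0, ∃ δ > 0, ∀ y ∈ A, dist y x < δ →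
      ∃ C ⊆ A, C ⊆ Metric.ball x ε ∧ IsPreconnected C ∧ x ∈ C ∧ y ∈ C) :
    ∃ δ > 0, ∀ x ∈ frontier A, ‖x‖ < δ →
      x ∈ connectedComponentIn (frontier A ∩ Metric.closedBall 0 s) 0 := by
  by_contra hcon
  push Not at hcon
  have hfA : frontier A ⊆ A := hA.frontier_subset
  obtain ⟨δ, hδ, hδC⟩ := hlc 0 (hfA h0) (by simpa using hs) s hs
  have key : ∀ n : ℕ, ∃ v, v ∉ A ∧ ‖v‖ < min (s / 2) (1 / ((n:ℝ) + 1)) ∧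
      (0:ℂ) ∉ closure (connectedComponentIn (Aᶜ ∩ Metric.ball 0 s) v) := by
    intro n
    set η := min (s / 2) (1 / ((n:ℝ) + 1)) with hηd
    have hη : 0 < η := lt_min (by positivity) (by positivity)
    have hηs : η ≤ s / 2 := min_le_left _ _
    obtain ⟨x, hx, hxη, hxn⟩ := hcon (min δ (η / 2)) (by positivity)
    have hx1 := hxη.trans_le (min_le_left _ _)
    have hx2 := hxη.trans_le (min_le_right _ _)
    obtain ⟨C, hCA, hCb, hC, h0C, hxC⟩ := hδC x (hfA hx) (by simpa using hx1)
    obtain ⟨v, hv, hvx, hvc⟩ := step_one hA hs h0 hx (by linarith) hxn hCA hCb hC h0C hxC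
      (half_pos hη)
    refine ⟨v, hv, ?_, hvc⟩
    rw [dist_eq_norm] at hvx
    have := norm_le_norm_add_norm_sub' v x
    linarith
  choose v hv hvn hvc using key
  refine no_seq hA hs (hfA h0) hnh hlc v hv (fun n => (hvn n).trans_le (min_le_left _ _)) ?_ hvc
  apply squeeze_zero_norm (fun n => ((hvn n).trans_le (min_le_right _ _)).le)
  exact tendsto_one_div_add_atTop_nhds_zero_nat

theorem core {T : Type*} [TopologicalSpace T] [T2Space T] [LocallyCompactSpace T]
    [PreconnectedSpace T] [LocallyConnectedSpace T] (π : T → ℂ) (σ : ℂ → T)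
    (hπ : Continuous π) (hl : ∀ t, σ (π t) = t) (hr : ∀ z, π (σ z) = z) (t0 : T)
    (h0 : π t0 = 0) (hD : ¬ ContinuousAt σ (π t0)) (W : Set T) (hW : W ∈ 𝓝 t0) :
    ∃ V ⊆ W, V ⊆ {t | ¬ ContinuousAt σ (π t)} ∧ IsPreconnected V ∧
      V ∈ 𝓝[{t | ¬ ContinuousAt σ (π t)}] t0 := by
  obtain ⟨N, hN, hNW, hNc⟩ := LocallyCompactSpace.local_compact_nhds t0 W hW
  have hinj : Function.Injective π := fun a b h => by rw [← hl a, ← hl b, h]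
  have hAc : IsCompact (π '' N) := hNc.image hπ
  have hA : IsClosed (π '' N) := hAc.isClosed
  have hmem : ∀ z, z ∈ π '' N ↔ σ z ∈ N := by
    intro z
    constructor
    · rintro ⟨t, ht, rfl⟩; rwa [hl]
    · intro h; exact ⟨σ z, h, hr z⟩
  have hmem' : ∀ t, π t ∈ π '' N ↔ t ∈ N := fun t => by rw [hmem, hl]
  -- continuity of σ on A
  have hσ : ContinuousOn σ (π '' N) := by
    rw [continuousOn_iff_isClosed]
    intro F hF
    refine ⟨π '' (N ∩ F), ((hNc.inter_right hF).image hπ).isClosed, ?_⟩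
    ext z
    constructor
    · rintro ⟨h1, h2⟩
      exact ⟨⟨σ z, ⟨(hmem z).1 h2, h1⟩, hr z⟩, h2⟩
    · rintro ⟨⟨t, ⟨ht, htF⟩, rfl⟩, h2⟩
      exact ⟨by simpa [hl] using htF, h2⟩
  -- radius
  obtain ⟨r, hr0, hrN⟩ : ∃ r > 0, ∀ t ∈ N, ‖π t‖ < r → t ∈ interior N := by
    have hB : IsClosed (π '' (N \ interior N)) :=
      ((hNc.diff isOpen_interior).image hπ).isClosed
    have hz : (0:ℂ) ∈ (π '' (N \ interior N))ᶜ := by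
      rintro ⟨t, ht, hte⟩
      have : t = t0 := hinj (by rw [hte, h0])
      exact ht.2 (this ▸ mem_interior_iff_mem_nhds.2 hN)
    obtain ⟨r, hr0, hh⟩ := Metric.isOpen_iff.1 hB.isOpen_compl 0 hz
    refine ⟨r, hr0, fun t ht htr => ?_⟩
    by_contra hc
    exact hh (by simpa using htr) ⟨t, ⟨ht, hc⟩, rfl⟩
  -- frontier
  have hfr : ∀ t ∈ N, ‖π t‖ < r → (¬ ContinuousAt σ (π t) ↔ π t ∈ frontier (π '' N)) := by
    intro t ht htr
    rw [hA.frontier_eq]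
    constructor
    · intro h
      refine ⟨(hmem' t).2 ht, fun hi => h ?_⟩
      exact hσ.continuousAt (mem_interior_iff_mem_nhds.1 hi)
    · rintro ⟨h1, h2⟩ hc
      apply h2
      rw [mem_interior_iff_mem_nhds]
      have h3 : N ∈ 𝓝 (σ (π t)) := by
        rw [hl]; exact mem_interior_iff_mem_nhds.1 (hrN t ht htr)
      filter_upwards [hc h3] with z hz
      exact (hmem z).2 hz
  have ht0N : t0 ∈ N := mem_of_mem_nhds hN
  have h0fr : (0:ℂ) ∈ frontier (π '' N) := by
    rw [← h0]; exact (hfr t0 ht0N (by rw [h0]; simpa using hr0)).1 hD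
  have hs : 0 < r / 2 := by linarith
  obtain ⟨δ, hδ, hδK⟩ := planar hA hs h0fr (by
    intro u hu hus
    by_contra hcon
    push Not at hcon
    set O := connectedComponentIn (π '' N)ᶜ u with hO
    have hOo : IsOpen O := hA.isOpen_compl.connectedComponentIn
    have hOA : O ⊆ (π '' N)ᶜ := connectedComponentIn_subset _ _
    have huO : u ∈ O := mem_connectedComponentIn hu
    have hOcl : closure O ⊆ Metric.closedBall 0 (r/2) :=
      closure_minimal (fun o ho => by simpa using hcon o ho) Metric.isClosed_closedBall
    have hcl : ∀ z ∈ closure O, z ∈ (π '' N)ᶜ → z ∈ O := by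
      intro z hz hzA
      have hp : IsPreconnected (insert z O) :=
        isPreconnected_connectedComponentIn.subset_closure (subset_insert _ _)
          (insert_subset hz subset_closure)
      exact hp.subset_connectedComponentIn (mem_insert_of_mem _ huO)
        (insert_subset hzA hOA) (mem_insert _ _)
    have heq : π ⁻¹' O = π ⁻¹' (closure O) ∩ (interior N)ᶜ := by
      ext t
      constructor
      · intro h
        exact ⟨subset_closure h, fun hi => hOA h ((hmem' t).2 (interior_subset hi))⟩
      · rintro ⟨h1, h2⟩
        refine hcl _ h1 fun hA' => h2 (hrN t ((hmem' t).1 hA') ?_)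
        have := hOcl h1
        simp at this
        linarith
    have hclopen : IsClopen (π ⁻¹' O) := by
      refine ⟨?_, hOo.preimage hπ⟩
      rw [heq]
      exact (isClosed_closure.preimage hπ).inter isOpen_interior.isClosed_compl
    have huniv := hclopen.eq_univ ⟨σ u, by simpa [hr] using huO⟩
    have : t0 ∈ π ⁻¹' O := huniv ▸ mem_univ _
    exact hOA this ((hmem' t0).2 ht0N)) (by
    rintro x hxA hxs ε hε
    have hxN := (hmem x).1 hxA
    have hxi : σ x ∈ interior N := hrN _ hxN (by rw [hr]; linarith)
    have hU : interior N ∩ π ⁻¹' (Metric.ball x ε) ∈ 𝓝 (σ x) :=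
      (isOpen_interior.inter (Metric.isOpen_ball.preimage hπ)).mem_nhds
        ⟨hxi, by simp [hr, hε]⟩
    obtain ⟨V, hV, hVp, hVU⟩ := locallyConnectedSpace_iff_connected_subsets.1
      inferInstance (σ x) _ hU
    have h1 := hσ x hxA hV
    rw [Filter.mem_map, Metric.mem_nhdsWithin_iff] at h1
    obtain ⟨δ, hδ, hh⟩ := h1
    refine ⟨δ, hδ, fun y hy hyx => ⟨π '' V, ?_, ?_, hVp.image _ hπ.continuousOn, ?_, ?_⟩⟩
    · exact image_mono fun t ht => interior_subset (hVU ht).1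
    · rintro _ ⟨t, ht, rfl⟩
      exact (hVU ht).2
    · exact ⟨σ x, mem_of_mem_nhds hV, hr x⟩
    · exact ⟨σ y, hh ⟨hyx, hy⟩, hr y⟩)
  set K := connectedComponentIn (frontier (π '' N) ∩ Metric.closedBall 0 (r/2)) 0 with hK
  have hKs : K ⊆ frontier (π '' N) ∩ Metric.closedBall 0 (r/2) := connectedComponentIn_subset _ _
  have hKA : K ⊆ π '' N := fun z hz => hA.frontier_subset (hKs hz).1
  refine ⟨σ '' K, ?_, ?_, ?_, ?_⟩
  · rintro _ ⟨z, hz, rfl⟩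
    exact hNW ((hmem z).1 (hKA hz))
  · rintro _ ⟨z, hz, rfl⟩
    have h2 := (hKs hz).2
    simp only [Metric.mem_closedBall, dist_zero_right] at h2
    refine (hfr (σ z) ((hmem z).1 (hKA hz)) (by rw [hr]; linarith)).2 ?_
    rw [hr]; exact (hKs hz).1
  · exact isPreconnected_connectedComponentIn.image _ (hσ.mono hKA)
  · have hnear : π ⁻¹' (Metric.ball 0 (min δ r)) ∈ 𝓝 t0 :=
      (Metric.isOpen_ball.preimage hπ).mem_nhds (by simp [h0, hδ, hr0])
    filter_upwards [mem_nhdsWithin_of_mem_nhds hN, mem_nhdsWithin_of_mem_nhds hnear,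
      self_mem_nhdsWithin] with t htN htb htD
    simp only [mem_preimage, Metric.mem_ball, dist_zero_right, lt_min_iff] at htb
    exact ⟨π t, hδK _ ((hfr t htN htb.2).1 htD) htb.1, hl t⟩

theorem stmt6 {Y : Type*} [TopologicalSpace Y] [LocallyCompactSpace Y]
    [SecondCountableTopology Y] [TopologicalSpace.MetrizableSpace Y]
    (f : ℝ × ℝ → Y)
    (hclosed : IsClosed (Set.range fun p => (p, f p)))
    (hconn : IsConnected (Set.range fun p => (p, f p)))
    (hlc : LocallyConnectedSpace (Set.range fun p => (p, f p))) :
    LocallyConnectedSpace ((fun p => (p, f p)) '' {p | ¬ ContinuousAt f p}) := by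
  rw [locallyConnectedSpace_iff_connected_subsets]
  rintro ⟨_, x0, hx0, rfl⟩ U hU
  let T := Set.range fun p => (p, f p)
  haveI : LocallyCompactSpace T := hclosed.isClosedEmbedding_subtypeVal.locallyCompactSpace
  haveI : PreconnectedSpace T := Subtype.preconnectedSpace hconn.isPreconnected
  haveI : LocallyConnectedSpace T := hlc
  let e : ℝ × ℝ ≃ₜ ℂ := (Homeomorph.subRight x0).trans Complex.equivRealProdCLM.symm.toHomeomorph
  have he0 : e x0 = 0 := by
    show Complex.equivRealProdCLM.symm (x0 - x0) = 0
    simp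
  let π : T → ℂ := fun t => e t.1.1
  let σ : ℂ → T := fun z => ⟨(e.symm z, f (e.symm z)), e.symm z, rfl⟩
  have hπ : Continuous π := e.continuous.comp (continuous_fst.comp continuous_subtype_val)
  have hl : ∀ t, σ (π t) = t := by
    rintro ⟨_, p, rfl⟩
    simp [σ, π]
  have hr : ∀ z, π (σ z) = z := by
    intro z; simp [σ, π]
  have hcont : ∀ p, ContinuousAt σ (e p) ↔ ContinuousAt f p := by
    intro p
    constructor
    · intro h
      have h1 : ContinuousAt (fun q => (σ (e q)).1.2) p :=
        (continuous_snd.comp continuous_subtype_val).continuousAt.comp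
          (ContinuousAt.comp (f := e) (g := σ) h e.continuous.continuousAt)
      simpa [σ] using h1
    · intro h
      rw [Topology.IsInducing.subtypeVal.continuousAt_iff]
      have h2 : ContinuousAt (fun z => f (e.symm z)) (e p) :=
        ContinuousAt.comp (by simpa using h) e.symm.continuous.continuousAt
      exact e.symm.continuous.continuousAt.prodMk h2
  let t0 : T := ⟨(x0, f x0), x0, rfl⟩
  rw [nhds_subtype, Filter.mem_comap] at hU
  obtain ⟨W, hW, hWU⟩ := hU
  obtain ⟨V, hVW, hVD, hVp, hVn⟩ := core π σ hπ hl hr t0 he0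
    (fun h => hx0 ((hcont x0).1 h)) (Subtype.val ⁻¹' W)
    (continuous_subtype_val.continuousAt.preimage_mem_nhds hW)
  have himg : Subtype.val '' (Subtype.val ⁻¹' (Subtype.val '' V) :
      Set ((fun p => (p, f p)) '' {p | ¬ ContinuousAt f p})) = Subtype.val '' V := by
    rw [Subtype.image_preimage_coe, inter_eq_right]
    rintro _ ⟨⟨_, p, rfl⟩, ht, rfl⟩
    exact ⟨p, fun h => hVD ht ((hcont p).2 h), rfl⟩
  refine ⟨Subtype.val ⁻¹' (Subtype.val '' V), ?_, ?_, ?_⟩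
  · rw [mem_nhdsWithin_iff_exists_mem_nhds_inter] at hVn
    obtain ⟨M, hM, hMV⟩ := hVn
    rw [nhds_subtype, Filter.mem_comap] at hM
    obtain ⟨M', hM', hMM⟩ := hM
    rw [nhds_subtype, Filter.mem_comap]
    refine ⟨M', hM', ?_⟩
    rintro ⟨_, p, hp, rfl⟩ hm
    exact ⟨⟨(p, f p), p, rfl⟩, hMV ⟨hMM hm, fun h => hp ((hcont p).1 h)⟩, rfl⟩
  · rw [← Topology.IsInducing.subtypeVal.isPreconnected_image, himg]
    exact hVp.image _ continuous_subtype_val.continuousOn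
  · rintro x ⟨t, ht, htx⟩
    apply hWU
    show x.1 ∈ W
    rw [← htx]
    exact hVW ht
end
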